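/- arXiv:2406.17422 — 3 statements merged into one kernel-verified Lean document; each statement's English description precedes it below -/
import Mathlib

section
/- With the generic frequency-domain parameterisation of an acyclic process graph G = (V, D), for all (not necessarily disjoint) subsets X, Y ⊆ V, the rank of [S]_{X,Y} as a matrix over the field 𝕂 equals min{ |Z_X| + |Z_Y| : (Z_X, Z_Y) t-separates X from Y }. -/
open Matrix
open scoped BigOperators

/-- A directed path in the graph with edge relation `E`: a nonempty list of vertices in
which consecutive vertices are joined by edges. A one-element list is the empty path at
that vertex. -/
structure DiPath {V : Type*} (E : V → V → Prop) where
  verts : List V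
  ne : verts ≠ []
  chain : verts.Chain' E

namespace DiPath

variable {V : Type*} {E : V → V → Prop}

/-- The starting point of a directed path. -/
def first (p : DiPath E) : V := p.verts.head p.ne

/-- The endpoint of a directed path. -/
def last (p : DiPath E) : V := p.verts.getLast p.ne

/-- The list of edges traversed by a directed path. -/
def edges (p : DiPath E) : List (V × V) := p.verts.zip p.verts.tail

/-- The weight of a directed path: the product of the matrix entries `H_{u,u'}` over all
its edges (an empty path has weight `1`). -/
def weight {K : Type*} [CommRing K] (H : Matrix V V K) (p : DiPath E) : K :=
  (p.edges.map fun e => H e.1 e.2).prod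

end DiPath

/-- A system of non-intersecting directed paths from the enumerated set
`X = {x 0, …, x (r-1)}` to `Y = {y 0, …, y (r-1)}`: paths with pairwise disjoint vertex
sets, the `i`-th path going from `x i` to `y (perm i)`. -/
structure PathSystem {V : Type*} (E : V → V → Prop) (r : ℕ) (x y : Fin r → V) where
  path : Fin r → DiPath E
  perm : Equiv.Perm (Fin r)
  first_eq : ∀ i, (path i).first = x i
  last_eq : ∀ i, (path i).last = y (perm i)
  disjoint : ∀ i j, i ≠ j → ∀ v ∈ (path i).verts, v ∉ (path j).verts

/-- The indeterminates of the generic parameterisation: `φ_{v,w,k}`, `ω_v` and `z`. -/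
inductive GVar (V : Type u) : Type u
  | phi (v w : V) (k : ℕ)
  | omega (v : V)
  | z

/-- The field `𝕂 = ℝ(Φ, Ω, z)`: the field of fractions of the real polynomial ring in all
the indeterminates `φ_{v,w,k}`, `ω_v` and `z`. -/
abbrev GField (V : Type u) : Type u := FractionRing (MvPolynomial (GVar V) ℝ)

/-- The image of an indeterminate in `𝕂`. -/
noncomputable def gv {V : Type*} (i : GVar V) : GField V :=
  algebraMap (MvPolynomial (GVar V) ℝ) (GField V) (MvPolynomial.X i)

/-- The image of a real constant in `𝕂`. -/
noncomputable def gconst {V : Type*} (a : ℝ) : GField V :=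
  algebraMap (MvPolynomial (GVar V) ℝ) (GField V) (MvPolynomial.C a)

/-- The generic lag polynomial `φ_{v,w}(z) = Σ_{k ∈ K(v,w)} φ_{v,w,k}·z^k` in `𝕂`. -/
noncomputable def lagPoly {V : Type*} (Kf : V × V → Finset ℕ) (v w : V) : GField V :=
  ∑ k ∈ Kf (v, w), gv (GVar.phi v w k) * gv GVar.z ^ k

/-- The generic direct transfer matrix `H` with `H_{v,w} = φ_{v,w}(z)/(1 − φ_{w,w}(z))` on
edges and `0` elsewhere. -/
noncomputable def Hmat {V : Type*} [DecidableEq V] (DO : Finset (V × V))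
    (Kf : V × V → Finset ℕ) : Matrix V V (GField V) :=
  fun v w => if (v, w) ∈ DO then lagPoly Kf v w / (1 - lagPoly Kf w w) else 0

/-- The generic internal spectrum: the diagonal matrix with entries
`ω_v/((1 − φ_{v,v}(z))·σ(1 − φ_{v,v}(z)))`. -/
noncomputable def SImat {V : Type*} [DecidableEq V] (Kf : V × V → Finset ℕ)
    (σ : GField V ≃+* GField V) : Matrix V V (GField V) :=
  Matrix.diagonal fun v =>
    gv (GVar.omega v) / ((1 - lagPoly Kf v v) * σ (1 - lagPoly Kf v v))

/-- The generic spectrum `S = ((I − H)ᵀ)⁻¹ · S^I · (I − H*)⁻¹`, where `H*` applies `σ`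
entrywise to `H`. -/
noncomputable def Smat {V : Type*} [Fintype V] [DecidableEq V] (DO : Finset (V × V))
    (Kf : V × V → Finset ℕ) (σ : GField V ≃+* GField V) : Matrix V V (GField V) :=
  ((1 - Hmat DO Kf)ᵀ)⁻¹ * SImat Kf σ * (1 - (Hmat DO Kf).map σ)⁻¹

/-- A trek: a pair of directed paths with a common starting vertex (the top). -/
structure Trek {V : Type*} (E : V → V → Prop) where
  left : DiPath E
  right : DiPath E
  top_eq : left.first = right.first

/-- The top of a trek. -/
def Trek.top {V : Type*} {E : V → V → Prop} (τ : Trek E) : V := τ.left.first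

/-- A trek system without sided intersection from the enumerated set
`X = {x 0, …, x (r-1)}` to `Y = {y 0, …, y (r-1)}`: the `i`-th trek has Left-endpoint `x i`
and Right-endpoint `y (perm i)`, no two Left-paths share a vertex, and no two Right-paths
share a vertex. -/
structure TrekSystem {V : Type*} (E : V → V → Prop) (r : ℕ) (x y : Fin r → V) where
  trek : Fin r → Trek E
  perm : Equiv.Perm (Fin r)
  left_last : ∀ i, (trek i).left.last = x i
  right_last : ∀ i, (trek i).right.last = y (perm i)
  left_disj : ∀ i j, i ≠ j → ∀ v ∈ (trek i).left.verts, v ∉ (trek j).left.verts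
  right_disj : ∀ i j, i ≠ j → ∀ v ∈ (trek i).right.verts, v ∉ (trek j).right.verts

/-- The pair `(ZX, ZY)` t-separates `X` from `Y`: every trek from a vertex of `X` to a
vertex of `Y` has the vertex set of its Left path meeting `ZX` or the vertex set of its
Right path meeting `ZY`. -/
def TSep {V : Type*} (E : V → V → Prop) (X Y ZX ZY : Finset V) : Prop :=
  ∀ τ : Trek E, τ.left.last ∈ X → τ.right.last ∈ Y →
    (∃ u ∈ τ.left.verts, u ∈ ZX) ∨ (∃ u ∈ τ.right.verts, u ∈ ZY)


/-! ### Matroid intersection for submodular functions -/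

theorem aux_matroid_inter {V : Type*} [DecidableEq V] (r1 r2 : Finset V → ℕ)
    (m1 : ∀ A B, A ⊆ B → r1 A ≤ r1 B) (m2 : ∀ A B, A ⊆ B → r2 A ≤ r2 B)
    (s1 : ∀ A B, r1 (A ∪ B) + r1 (A ∩ B) ≤ r1 A + r1 B)
    (s2 : ∀ A B, r2 (A ∪ B) + r2 (A ∩ B) ≤ r2 A + r2 B)
    (u1 : ∀ A t, r1 (insert t A) ≤ r1 A + 1) (u2 : ∀ A t, r2 (insert t A) ≤ r2 A + 1)
    (T : Finset V) : ∀ C : Finset V, ∃ I U : Finset V, U ⊆ T ∧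
      r1 (C ∪ I) = r1 C + I.card ∧ r2 (C ∪ I) = r2 C + I.card ∧
      r1 (C ∪ U) + r2 (C ∪ (T \ U)) ≤ I.card + r1 C + r2 C := by
  induction T using Finset.induction_on with
  | empty => intro C; exact ⟨∅, ∅, by simp, by simp, by simp, by simp⟩
  | insert t T ht ih =>
    intro C
    obtain ⟨I1, W, hW, a1, a2, a3⟩ := ih C
    by_cases h1 : r1 (insert t C) ≤ r1 C
    · refine ⟨I1, insert t W, Finset.insert_subset_insert _ hW, a1, a2, ?_⟩
      have e1 : insert t T \ insert t W = T \ W := by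
        ext x; simp only [Finset.mem_sdiff, Finset.mem_insert]
        constructor
        · tauto
        · rintro ⟨h, h'⟩; refine ⟨Or.inr h, ?_⟩; rintro (rfl | h'') <;> tauto
      rw [e1]
      have := s1 (C ∪ W) (insert t C)
      have h2 := m1 C ((C ∪ W) ∩ insert t C) (by intro x; simp; tauto)
      have h3 : (C ∪ W) ∪ insert t C = C ∪ insert t W := by ext x; simp; tauto
      rw [h3] at this
      omega
    by_cases h2 : r2 (insert t C) ≤ r2 C
    · refine ⟨I1, W, hW.trans (Finset.subset_insert _ _), a1, a2, ?_⟩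
      have := s2 (C ∪ (T \ W)) (insert t C)
      have h2 := m2 C ((C ∪ (T \ W)) ∩ insert t C) (by intro x; simp; tauto)
      have h3 := m2 (C ∪ (insert t T \ W)) ((C ∪ (T \ W)) ∪ insert t C)
        (by intro x; simp; tauto)
      omega
    obtain ⟨I2, U, hU, b1, b2, b3⟩ := ih (insert t C)
    have u1' := u1 C t
    have u2' := u2 C t
    have key1 := s1 (insert t C ∪ U) (C ∪ W)
    have key2 := s2 (insert t C ∪ (T \ U)) (C ∪ (T \ W))
    -- cut A
    have cA1 := m1 (C ∪ insert t (U ∪ W)) ((insert t C ∪ U) ∪ (C ∪ W))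
      (by intro x; simp; tauto)
    have cA2 := m2 (C ∪ (insert t T \ insert t (U ∪ W)))
      ((insert t C ∪ (T \ U)) ∩ (C ∪ (T \ W))) (by intro x; simp; tauto)
    have cB1 := m1 (C ∪ (U ∩ W)) ((insert t C ∪ U) ∩ (C ∪ W)) (by intro x; simp; tauto)
    have cB2 := m2 (C ∪ (insert t T \ (U ∩ W)))
      ((insert t C ∪ (T \ U)) ∪ (C ∪ (T \ W))) (by intro x; simp; tauto)
    have hA : insert t (U ∪ W) ⊆ insert t T :=
      Finset.insert_subset_insert _ (Finset.union_subset hU hW)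
    have hB : U ∩ W ⊆ insert t T :=
      (Finset.inter_subset_left.trans hU).trans (Finset.subset_insert _ _)
    by_cases hI : I2.card + 1 ≤ I1.card
    · by_cases hc : r1 (C ∪ insert t (U ∪ W)) + r2 (C ∪ (insert t T \ insert t (U ∪ W))) ≤
        I1.card + r1 C + r2 C
      · exact ⟨I1, _, hA, a1, a2, hc⟩
      · exact ⟨I1, _, hB, a1, a2, by omega⟩
    · have htI : t ∉ I2 := by
        intro h
        have e : insert t C ∪ I2 = insert t C ∪ I2.erase t := by
          ext x; by_cases hx : x = t <;> simp [hx]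
        have : ∀ J : Finset V, r1 (insert t C ∪ J) ≤ r1 (insert t C) + J.card := by
          intro J
          induction J using Finset.induction_on with
          | empty => simp
          | insert a J ha ihJ =>
            rw [Finset.union_insert, Finset.card_insert_of_notMem ha]
            have := u1 (insert t C ∪ J) a
            omega
        have h' := this (I2.erase t)
        rw [← e, b1, Finset.card_erase_of_mem h] at h'
        have := Finset.card_pos.2 ⟨t, h⟩
        omega
      have e : C ∪ insert t I2 = insert t C ∪ I2 := by ext x; simp
      have c1 : r1 (C ∪ insert t I2) = r1 C + (insert t I2).card := by
        rw [e, b1, Finset.card_insert_of_notMem htI]; omega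
      have c2 : r2 (C ∪ insert t I2) = r2 C + (insert t I2).card := by
        rw [e, b2, Finset.card_insert_of_notMem htI]; omega
      have c3 := Finset.card_insert_of_notMem htI
      by_cases hc : r1 (C ∪ insert t (U ∪ W)) + r2 (C ∪ (insert t T \ insert t (U ∪ W))) ≤
        (insert t I2).card + r1 C + r2 C
      · exact ⟨_, _, hA, c1, c2, hc⟩
      · exact ⟨_, _, hB, c1, c2, by omega⟩

set_option linter.unusedSectionVars false

/-! ### Rank function of a vector configuration -/

/-- Rank of a subconfiguration of vectors. -/
noncomputable def auxr {V K M : Type*} [Field K] [AddCommGroup M] [Module K M] (p : V → M)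
    (A : Finset V) : ℕ := Module.finrank K (Submodule.span K (p '' (A : Set V)))

section auxr
variable {V K M : Type*} [DecidableEq V] [Field K] [AddCommGroup M] [Module K M]
  [FiniteDimensional K M] (p : V → M)

theorem auxr_mono (A B : Finset V) (h : A ⊆ B) : auxr (K := K) p A ≤ auxr (K := K) p B :=
  Submodule.finrank_mono (Submodule.span_mono (Set.image_mono (by exact_mod_cast h)))

theorem auxr_sub (A B : Finset V) : auxr (K := K) p (A ∪ B) + auxr (K := K) p (A ∩ B) ≤
    auxr (K := K) p A + auxr (K := K) p B := by
  unfold auxr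
  rw [← Submodule.finrank_sup_add_finrank_inf_eq (Submodule.span K (p '' (A : Set V))), Finset.coe_union, Set.image_union,
    Submodule.span_union]
  refine Nat.add_le_add_left (Submodule.finrank_mono ?_) _
  exact le_inf (Submodule.span_mono (Set.image_mono (by simp)))
    (Submodule.span_mono (Set.image_mono (by simp)))

theorem auxr_insert_le (A : Finset V) (t : V) :
    auxr (K := K) p (insert t A) ≤ auxr (K := K) p A + 1 := by
  unfold auxr
  rw [Finset.coe_insert, Set.image_insert_eq, Submodule.span_insert, add_comm]
  refine (Submodule.finrank_add_le_finrank_add_finrank _ _).trans ?_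
  gcongr
  simpa using finrank_span_le_card (R := K) ({p t} : Set M)

theorem auxr_insert_ge (A : Finset V) (t : V)
    (h : p t ∉ Submodule.span K (p '' (A : Set V))) :
    auxr (K := K) p A + 1 ≤ auxr (K := K) p (insert t A) := by
  unfold auxr
  apply Submodule.finrank_lt_finrank_of_lt
  refine lt_of_le_of_ne (Submodule.span_mono (Set.image_mono (by simp))) ?_
  intro e
  apply h
  rw [e]
  exact Submodule.subset_span ⟨t, by simp, rfl⟩

theorem auxr_le_card (A : Finset V) : auxr (K := K) p A ≤ A.card := by
  classical
  unfold auxr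
  rw [← Finset.coe_image]
  exact (finrank_span_finset_le_card _).trans Finset.card_image_le

end auxr

theorem aux_right_inv {V K ι : Type*} [DecidableEq V] [Field K] [Fintype ι]
    (p : V → ι → K) (I : Finset V) (h : auxr (K := K) p I = I.card) :
    ∃ L : Matrix ι {v // v ∈ I} K,
      (Matrix.of fun (i : {v // v ∈ I}) (x : ι) => p i x) * L = 1 := by
  classical
  have hli : LinearIndependent K (fun i : {v // v ∈ I} => p i) := by
    rw [linearIndependent_iff_card_eq_finrank_span]
    unfold auxr at h
    rw [Set.finrank]
    have : Set.range (fun i : {v // v ∈ I} => p i) = p '' (I : Set V) := by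
      ext x; simp
    rw [this, h]; simp
  rw [← Matrix.mulVec_surjective_iff_exists_right_inverse]
  have hr : (Matrix.of fun (i : {v // v ∈ I}) (x : ι) => p i x).rank = Fintype.card {v // v ∈ I} :=
    LinearIndependent.rank_matrix hli
  have : LinearMap.range (Matrix.of fun (i : {v // v ∈ I}) (x : ι) => p i x).mulVecLin = ⊤ := by
    apply Submodule.eq_top_of_finrank_eq
    rw [← Matrix.rank, hr]; simp
  intro y
  have hy : y ∈ LinearMap.range (Matrix.of fun (i : {v // v ∈ I}) (x : ι) => p i x).mulVecLin := by
    rw [this]; trivial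
  exact hy

theorem aux_rank_factor {K m n : Type*} [Field K] [Fintype m] [Fintype n]
    (M : Matrix m n K) : ∃ (A : Matrix m (Fin M.rank) K) (B : Matrix (Fin M.rank) n K),
      M = A * B := by
  classical
  have hW : M.rank = Module.finrank K (Submodule.span K (Set.range M.col)) :=
    M.rank_eq_finrank_span_cols
  let b := (Module.finBasis K (Submodule.span K (Set.range M.col))).reindex (finCongr hW.symm)
  have hm : ∀ j, M.col j ∈ Submodule.span K (Set.range M.col) :=
    fun j => Submodule.subset_span ⟨j, rfl⟩
  refine ⟨Matrix.of fun i k => (b k : m → K) i, Matrix.of fun k j => b.repr ⟨M.col j, hm j⟩ k, ?_⟩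
  ext i j
  have := congrArg (fun w : Submodule.span K (Set.range M.col) => (w : m → K) i) (b.sum_repr ⟨M.col j, hm j⟩)
  simp only [AddSubmonoidClass.coe_finsetSum, Submodule.coe_smul, Finset.sum_apply,
    Pi.smul_apply, smul_eq_mul, Matrix.col_apply] at this
  rw [← this, Matrix.mul_apply]
  simp [mul_comm]

theorem aux_rank_map_le {K m n : Type*} [Field K] [Fintype m] [Fintype n]
    (M : Matrix m n K) (τ : K →+* K) : (M.map τ).rank ≤ M.rank := by
  obtain ⟨A, B, h⟩ := aux_rank_factor M
  have : M.map τ = A.map τ * B.map τ := by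
    conv_lhs => rw [h]
    rw [Matrix.map_mul]
  rw [this]
  refine (Matrix.rank_mul_le_left _ _).trans ((Matrix.rank_le_card_width _).trans (by simp))

theorem aux_rank_add_le {K m n : Type*} [Field K] [Fintype m] [Fintype n]
    (A B : Matrix m n K) : (A + B).rank ≤ A.rank + B.rank := by
  unfold Matrix.rank
  rw [Matrix.mulVecLin_add]
  refine (Submodule.finrank_mono (?_ : _ ≤ LinearMap.range A.mulVecLin ⊔ LinearMap.range B.mulVecLin)).trans
    (Submodule.finrank_add_le_finrank_add_finrank _ _)
  rintro _ ⟨x, rfl⟩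
  exact Submodule.add_mem_sup ⟨x, rfl⟩ ⟨x, rfl⟩


/-! ### The path matrix of an acyclic graph -/

theorem aux_order {V : Type*} [Fintype V] (E : V → V → Prop)
    (hacyc : ∀ v : V, ¬ Relation.TransGen E v v) :
    ∃ f : V → ℕ, Function.Injective f ∧ ∀ v w, E v w → f w < f v := by
  classical
  let g : V → ℕ := fun v => (Finset.univ.filter fun w => Relation.TransGen E v w).card
  have hg : ∀ v w, E v w → g w < g v := by
    intro v w h
    apply Finset.card_lt_card
    rw [Finset.ssubset_iff_of_subset]
    · exact ⟨w, by simpa using Relation.TransGen.single h, by simpa using hacyc w⟩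
    · intro x hx
      simp only [Finset.mem_filter, Finset.mem_univ, true_and] at hx ⊢
      exact Relation.TransGen.head h hx
  let e := Fintype.equivFin V
  refine ⟨fun v => g v * Fintype.card V + e v, ?_, ?_⟩
  · intro v w h
    have h : g v * Fintype.card V + e v = g w * Fintype.card V + e w := h
    have := congrArg (· % Fintype.card V) h
    simp only [Nat.mul_add_mod_self_right, Nat.mod_eq_of_lt (e v).2, Nat.mod_eq_of_lt (e w).2]
      at this
    exact e.injective (Fin.ext this)
  · intro v w h
    have h1 := hg v w h
    have h2 := (e w).2
    have h3 : (g w + 1) * Fintype.card V ≤ g v * Fintype.card V := Nat.mul_le_mul_right _ h1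
    rw [add_mul, one_mul] at h3
    show g w * Fintype.card V + e w < g v * Fintype.card V + e v
    omega

/-- `Z` meets all directed paths from `a` to `X`. -/
def AuxCut {V : Type*} (E : V → V → Prop) (X Z : Finset V) (a : V) : Prop :=
  ∀ p : DiPath E, p.first = a → p.last ∈ X → ∃ u ∈ p.verts, u ∈ Z

theorem AuxCut.mono {V : Type*} {E : V → V → Prop} {X Z Z' : Finset V} {a : V}
    (h : AuxCut E X Z a) (hZ : Z ⊆ Z') : AuxCut E X Z' a := by
  intro p h1 h2
  obtain ⟨u, hu, hu'⟩ := h p h1 h2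
  exact ⟨u, hu, hZ hu'⟩

theorem AuxCut.self {V : Type*} {E : V → V → Prop} {X Z : Finset V} {a : V}
    (h : a ∈ Z) : AuxCut E X Z a := by
  intro p h1 h2
  exact ⟨a, by rw [← h1]; exact List.head_mem _, h⟩

/-- The one-vertex path. -/
def auxNil {V : Type*} (E : V → V → Prop) (a : V) : DiPath E :=
  ⟨[a], by simp, by simp [List.Chain']⟩

/-- Prepend a vertex to a path. -/
def auxCons {V : Type*} {E : V → V → Prop} (a : V) (p : DiPath E) (h : E a p.first) : DiPath E :=
  ⟨a :: p.verts, by simp, by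
    rcases p with ⟨_ | ⟨b, l⟩, hne, hc⟩
    · exact absurd rfl hne
    · exact List.isChain_cons_cons.2 ⟨h, hc⟩⟩

theorem AuxCut.notMem {V : Type*} {E : V → V → Prop} {X Z : Finset V} {a : V}
    (h : AuxCut E X Z a) (ha : a ∉ Z) : a ∉ X := by
  intro hX
  obtain ⟨u, hu, hu'⟩ := h (auxNil E a) rfl hX
  simp only [auxNil, List.mem_singleton] at hu
  exact ha (hu ▸ hu')

theorem AuxCut.child {V : Type*} {E : V → V → Prop} {X Z : Finset V} {a w : V}
    (h : AuxCut E X Z a) (ha : a ∉ Z) (hw : E a w) : AuxCut E X Z w := by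
  intro p h1 h2
  obtain ⟨u, hu, hu'⟩ := h (auxCons a p (h1 ▸ hw)) rfl
    (by simpa [DiPath.last, auxCons, List.getLast_cons p.ne] using h2)
  simp only [auxCons, List.mem_cons] at hu
  rcases hu with rfl | hu
  · exact absurd hu' ha
  · exact ⟨u, hu, hu'⟩

theorem AuxCut.of_children {V : Type*} {E : V → V → Prop} {X Z : Finset V} {a : V}
    (ha : a ∉ X) (h : ∀ w, E a w → AuxCut E X Z w) : AuxCut E X Z a := by
  rintro ⟨_ | ⟨b, _ | ⟨c, l⟩⟩, hne, hc⟩ h1 h2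
  · exact absurd rfl hne
  · simp only [DiPath.first, List.head_cons] at h1
    simp only [DiPath.last, List.getLast_singleton] at h2
    exact absurd (h1 ▸ h2) ha
  · simp only [DiPath.first, List.head_cons] at h1
    subst h1
    obtain ⟨e, hc'⟩ := List.isChain_cons_cons.1 hc
    obtain ⟨u, hu, hu'⟩ := h c e ⟨c :: l, by simp, hc'⟩ rfl
      (by simpa [DiPath.last] using h2)
    exact ⟨u, List.mem_cons_of_mem _ hu, hu'⟩

section pathmat
variable {V K : Type*} [Fintype V] [DecidableEq V] [Field K] {E : V → V → Prop} {f : V → ℕ}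
  (hf : ∀ v w, E v w → f w < f v) {H : Matrix V V K} (hH : ∀ v w, ¬ E v w → H v w = 0)

theorem aux_isUnit_det (f : V → ℕ) (hf : ∀ v w, E v w → f w < f v) (H : Matrix V V K)
    (hH : ∀ v w, ¬ E v w → H v w = 0) : IsUnit (1 - H).det := by
  rw [isUnit_iff_ne_zero]
  intro h0
  obtain ⟨x, hx, hx0⟩ := Matrix.exists_mulVec_eq_zero_iff.2 h0
  apply hx
  have : ∀ n, ∀ v, f v < n → x v = 0 := by
    intro n
    induction n with
    | zero => intro v h; omega
    | succ n ih =>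
      intro v hv
      have h1 := congrFun hx0 v
      rw [Matrix.sub_mulVec, Matrix.one_mulVec, Pi.sub_apply, Pi.zero_apply, sub_eq_zero] at h1
      rw [h1, Matrix.mulVec, dotProduct]
      apply Finset.sum_eq_zero
      intro w _
      by_cases hE : E v w
      · rw [ih w (by have := hf v w hE; omega), mul_zero]
      · rw [hH v w hE, zero_mul]
  funext v
  exact this _ v (Nat.lt_succ_self _)

theorem aux_P_rec (f : V → ℕ) (hf : ∀ v w, E v w → f w < f v) (H : Matrix V V K)
    (hH : ∀ v w, ¬ E v w → H v w = 0) (v x : V) :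
    (1 - H)⁻¹ v x = (if v = x then 1 else 0) + ∑ w, H v w * (1 - H)⁻¹ w x := by
  have h := Matrix.mul_nonsing_inv (1 - H) (aux_isUnit_det f hf H hH)
  rw [sub_mul, one_mul, sub_eq_iff_eq_add] at h
  conv_lhs => rw [h]
  rw [Matrix.add_apply, Matrix.mul_apply, Matrix.one_apply]

theorem aux_P_zero (f : V → ℕ) (hf : ∀ v w, E v w → f w < f v) (H : Matrix V V K)
    (hH : ∀ v w, ¬ E v w → H v w = 0) (t : V) : ∀ n a, f a < n → f a < f t →
    (1 - H)⁻¹ a t = 0 := by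
  intro n
  induction n with
  | zero => intro v h; omega
  | succ n ih =>
    intro a h1 h2
    rw [aux_P_rec f hf H hH, if_neg (by rintro rfl; omega), zero_add]
    apply Finset.sum_eq_zero
    intro w _
    by_cases hE : E a w
    · have := hf _ _ hE
      rw [ih w (by omega) (by omega), mul_zero]
    · rw [hH _ _ hE, zero_mul]

theorem aux_P_one (f : V → ℕ) (hf : ∀ v w, E v w → f w < f v) (H : Matrix V V K)
    (hH : ∀ v w, ¬ E v w → H v w = 0) (t : V) : (1 - H)⁻¹ t t = 1 := by
  rw [aux_P_rec f hf H hH, if_pos rfl, add_eq_left]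
  apply Finset.sum_eq_zero
  intro w _
  by_cases hE : E t w
  · rw [aux_P_zero f hf H hH t _ w (Nat.lt_succ_self _) (hf _ _ hE), mul_zero]
  · rw [hH _ _ hE, zero_mul]

/-- Row of the path matrix, restricted to `X`. -/
noncomputable def auxp (H : Matrix V V K) (X : Finset V) (t : V) : {u // u ∈ X} → K :=
  fun x => (1 - H)⁻¹ t x

theorem auxp_rec (f : V → ℕ) (hf : ∀ v w, E v w → f w < f v) (H : Matrix V V K)
    (hH : ∀ v w, ¬ E v w → H v w = 0) (X : Finset V) (t : V) (ht : t ∉ X) :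
    auxp H X t = ∑ w, H t w • auxp H X w := by
  funext x
  simp only [auxp, Finset.sum_apply, Pi.smul_apply, smul_eq_mul]
  rw [aux_P_rec f hf H hH, if_neg (by rintro rfl; exact ht x.2), zero_add]

theorem auxp_mem_span (f : V → ℕ) (hf : ∀ v w, E v w → f w < f v) (H : Matrix V V K)
    (hH : ∀ v w, ¬ E v w → H v w = 0) (X Z : Finset V) : ∀ n a, f a < n → AuxCut E X Z a →
    auxp H X a ∈ Submodule.span K (auxp H X '' (Z : Set V)) := by
  intro n
  induction n with
  | zero => intro v h; omega
  | succ n ih =>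
    intro a h1 h2
    by_cases ha : a ∈ Z
    · exact Submodule.subset_span ⟨a, ha, rfl⟩
    rw [auxp_rec f hf H hH X a (h2.notMem ha)]
    apply Submodule.sum_mem
    intro w _
    by_cases hE : E a w
    · have := hf _ _ hE
      exact Submodule.smul_mem _ _ (ih w (by omega) (h2.child ha hE))
    · rw [hH _ _ hE, zero_smul]; exact Submodule.zero_mem _

/-- Rank bound for one half of the trek expansion. -/
theorem aux_half_rank (f : V → ℕ) (hf : ∀ v w, E v w → f w < f v) (H : Matrix V V K)
    (hH : ∀ v w, ¬ E v w → H v w = 0) (X Z : Finset V) (d : V → K)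
    (hd : ∀ t, d t ≠ 0 → AuxCut E X Z t) :
    (Matrix.of fun (x : {u // u ∈ X}) (t : V) => (1 - H)⁻¹ t x * d t).rank ≤ Z.card := by
  rw [Matrix.rank_eq_finrank_span_cols]
  refine le_trans (Submodule.finrank_mono ?_) (auxr_le_card (K := K) (auxp H X) Z)
  rw [Submodule.span_le]
  rintro _ ⟨t, rfl⟩
  have : (Matrix.of fun (x : {u // u ∈ X}) (t : V) => (1 - H)⁻¹ t x * d t).col t
      = d t • auxp H X t := by
    funext x
    simp [auxp, mul_comm]
  rw [this]
  by_cases h : d t = 0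
  · rw [h, zero_smul]; exact Submodule.zero_mem _
  · exact Submodule.smul_mem _ _ (auxp_mem_span f hf H hH X Z _ t (Nat.lt_succ_self _) (hd t h))

/-- Upper bound. -/
theorem aux_upper (f : V → ℕ) (hf : ∀ v w, E v w → f w < f v) (H H' : Matrix V V K)
    (hH : ∀ v w, ¬ E v w → H v w = 0) (hH' : ∀ v w, ¬ E v w → H' v w = 0)
    (X Y ZX ZY : Finset V) (d : V → K) (hsep : TSep E X Y ZX ZY) :
    ((((1 - H)⁻¹)ᵀ * Matrix.diagonal d * (1 - H')⁻¹).submatrix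
      (fun a : {u // u ∈ X} => (a : V)) (fun b : {u // u ∈ Y} => (b : V))).rank ≤
    ZX.card + ZY.card := by
  classical
  have hcut : ∀ t, AuxCut E X ZX t ∨ AuxCut E Y ZY t := by
    intro t
    by_contra! hc
    simp only [AuxCut, not_forall] at hc
    obtain ⟨⟨p, p1, p2, p3⟩, ⟨q, q1, q2, q3⟩⟩ := hc
    rcases hsep ⟨p, q, p1.trans q1.symm⟩ p2 q2 with h | h
    · exact p3 h
    · exact q3 h
  have e : (((1 - H)⁻¹)ᵀ * Matrix.diagonal d * (1 - H')⁻¹).submatrix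
      (fun a : {u // u ∈ X} => (a : V)) (fun b : {u // u ∈ Y} => (b : V)) =
      (Matrix.of fun (x : {u // u ∈ X}) (t : V) =>
        (1 - H)⁻¹ t x * (if AuxCut E X ZX t then 1 else 0)) *
      (Matrix.of fun (t : V) (y : {u // u ∈ Y}) => d t * (1 - H')⁻¹ t y) +
      (Matrix.of fun (x : {u // u ∈ X}) (t : V) => (1 - H)⁻¹ t x * d t) *
      (Matrix.of fun (y : {u // u ∈ Y}) (t : V) =>
        (1 - H')⁻¹ t y * (if AuxCut E X ZX t then 0 else 1))ᵀ := by
    ext x y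
    rw [Matrix.submatrix_apply, Matrix.mul_apply, Matrix.add_apply, Matrix.mul_apply,
      Matrix.mul_apply, ← Finset.sum_add_distrib]
    refine Finset.sum_congr rfl fun t _ => ?_
    rw [Matrix.mul_diagonal]
    simp only [Matrix.transpose_apply, Matrix.of_apply]
    split_ifs <;> ring
  rw [e]
  refine (aux_rank_add_le _ _).trans (Nat.add_le_add ?_ ?_)
  · refine (Matrix.rank_mul_le_left _ _).trans (aux_half_rank f hf H hH X ZX _ ?_)
    intro t ht
    by_contra hc
    exact ht (if_neg hc)
  · refine (Matrix.rank_mul_le_right _ _).trans ?_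
    rw [Matrix.rank_transpose]
    refine aux_half_rank f hf H' hH' Y ZY _ ?_
    intro t ht
    refine (hcut t).resolve_left ?_
    intro hc
    exact ht (if_pos hc)

end pathmat

section generic
variable {V K : Type*} [Fintype V] [DecidableEq V] [Field K] {E : V → V → Prop}

theorem aux_P_fixed (f : V → ℕ) (hf : ∀ v w, E v w → f w < f v) (H : Matrix V V K)
    (hH : ∀ v w, ¬ E v w → H v w = 0) (τ : K →+* K) (t : V)
    (hτ : ∀ v w, v ≠ t → w ≠ t → τ (H v w) = H v w) (x : V) :
    ∀ n a, f a < n → f a < f t → τ ((1 - H)⁻¹ a x) = (1 - H)⁻¹ a x := by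
  intro n
  induction n with
  | zero => intro v h; omega
  | succ n ih =>
    intro a h1 h2
    rw [aux_P_rec f hf H hH, map_add, map_sum]
    congr 1
    · split_ifs <;> simp
    · refine Finset.sum_congr rfl fun w _ => ?_
      by_cases hE : E a w
      · have := hf _ _ hE
        rw [map_mul, ih w (by omega) (by omega), hτ a w (by rintro rfl; omega)
          (by rintro rfl; omega)]
      · rw [hH _ _ hE, zero_mul, map_zero]

theorem aux_generic_step (f : V → ℕ) (hf : ∀ v w, E v w → f w < f v)
    (H : Matrix V V K)
    (hH : ∀ v w, ¬ E v w → H v w = 0) (X : Finset V) (A : Finset V) (t s0 : V) (hE : E t s0)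
    (htX : t ∉ X) (hA : ∀ a ∈ A, f a < f t) (τ : K →+* K) (c : K) (hc : c ≠ 0)
    (hτ : ∀ v w, v ≠ t → w ≠ t → τ (H v w) = H v w)
    (hτ1 : ∀ s, s ≠ s0 → τ (H t s) = H t s) (hτ2 : τ (H t s0) = H t s0 + c)
    (hs0 : auxp H X s0 ∉ Submodule.span K (auxp H X '' (A : Set V))) :
    auxp H X t ∉ Submodule.span K (auxp H X '' (A : Set V)) := by
  intro hmem
  apply hs0
  have hfix : ∀ a, f a < f t → (fun x => τ (auxp H X a x)) = auxp H X a := by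
    intro a ha
    funext x
    exact aux_P_fixed f hf H hH τ t hτ x _ a (Nat.lt_succ_self _) ha
  have h1' : ∀ y ∈ Submodule.span K (auxp H X '' (A : Set V)),
      (fun x => τ (y x)) ∈ Submodule.span K (auxp H X '' (A : Set V)) := by
    intro y hmem
    induction hmem using Submodule.span_induction with
    | mem y hy =>
      obtain ⟨a, ha, rfl⟩ := hy
      rw [hfix a (hA a ha)]
      exact Submodule.subset_span ⟨a, ha, rfl⟩
    | zero =>
      simp only [Pi.zero_apply, map_zero]
      exact Submodule.zero_mem _
    | add y z _ _ hy hz =>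
      have : (fun x => τ ((y + z) x)) = (fun x => τ (y x)) + (fun x => τ (z x)) := by
        funext x; simp
      rw [this]
      exact Submodule.add_mem _ hy hz
    | smul b y _ hy =>
      have : (fun x => τ ((b • y) x)) = τ b • (fun x => τ (y x)) := by
        funext x; simp
      rw [this]
      exact Submodule.smul_mem _ _ hy
  have h1 := h1' _ hmem
  have h2 : (fun x => τ (auxp H X t x)) = auxp H X t + c • auxp H X s0 := by
    have hrec := auxp_rec f hf H hH X t htX
    funext x
    have hx := congrFun hrec x
    simp only [Finset.sum_apply, Pi.smul_apply, smul_eq_mul] at hx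
    rw [Pi.add_apply, hx, map_sum, Pi.smul_apply, smul_eq_mul,
      ← Finset.add_sum_erase _ _ (Finset.mem_univ s0),
      ← Finset.add_sum_erase _ (fun w => H t w * auxp H X w x) (Finset.mem_univ s0)]
    have : ∀ w, E t w → τ (auxp H X w x) = auxp H X w x :=
      fun w hw => congrFun (hfix w (hf _ _ hw)) x
    rw [map_mul, hτ2, this s0 hE]
    have e : ∑ w ∈ Finset.univ.erase s0, τ (H t w * auxp H X w x) =
        ∑ w ∈ Finset.univ.erase s0, H t w * auxp H X w x := by
      refine Finset.sum_congr rfl fun w hw => ?_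
      by_cases hEw : E t w
      · rw [map_mul, this w hEw, hτ1 w (Finset.ne_of_mem_erase hw)]
      · rw [hH _ _ hEw, zero_mul, map_zero]
    rw [e]
    ring
  rw [h2] at h1
  have h3 := Submodule.sub_mem _ h1 hmem
  rw [add_sub_cancel_left] at h3
  exact (Submodule.smul_mem_iff _ hc).1 h3

theorem aux_menger (f : V → ℕ) (hf : ∀ v w, E v w → f w < f v) (hinj : Function.Injective f)
    (H : Matrix V V K) (hH : ∀ v w, ¬ E v w → H v w = 0)
    (hgen : ∀ t s0, E t s0 → ∃ (τ : K →+* K) (c : K), c ≠ 0 ∧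
      (∀ v w, v ≠ t → w ≠ t → τ (H v w) = H v w) ∧
      (∀ s, s ≠ s0 → τ (H t s) = H t s) ∧ τ (H t s0) = H t s0 + c) (X : Finset V) :
    ∀ n, ∀ A : Finset V, (∀ a ∈ A, f a < n) → ∃ Z : Finset V,
      Z.card ≤ auxr (K := K) (auxp H X) A ∧ ∀ a ∈ A, AuxCut E X Z a := by
  classical
  intro n
  induction n with
  | zero =>
    intro A hA
    exact ⟨∅, by simp, fun a ha => absurd (hA a ha) (by omega)⟩
  | succ n ih =>
    intro A hA
    by_cases hex : ∃ t ∈ A, f t = n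
    swap
    · push Not at hex
      exact ih A fun a ha => lt_of_le_of_ne (Nat.lt_succ_iff.1 (hA a ha)) (hex a ha)
    obtain ⟨t, ht, hft⟩ := hex
    have hA' : ∀ a ∈ A.erase t, f a < n := by
      intro a ha
      have h1 := hA a (Finset.mem_of_mem_erase ha)
      have h2 : f a ≠ n := fun h => Finset.ne_of_mem_erase ha (hinj (h.trans hft.symm))
      omega
    obtain ⟨Z', hZ', hc'⟩ := ih _ hA'
    have hfin : auxp H X t ∉ Submodule.span K (auxp H X '' ((A.erase t : Finset V) : Set V)) →
        ∃ Z : Finset V, Z.card ≤ auxr (K := K) (auxp H X) A ∧ ∀ a ∈ A, AuxCut E X Z a := by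
      intro h
      refine ⟨insert t Z', ?_, ?_⟩
      · have := auxr_insert_ge (K := K) (auxp H X) _ t h
        rw [Finset.insert_erase ht] at this
        have := Finset.card_insert_le t Z'
        omega
      · intro a ha
        by_cases hat : a = t
        · subst hat; exact AuxCut.self (by simp)
        · exact (hc' a (Finset.mem_erase.2 ⟨hat, ha⟩)).mono (Finset.subset_insert _ _)
    by_cases htX : t ∈ X
    · apply hfin
      intro hmem
      have h0 : ∀ y ∈ Submodule.span K (auxp H X '' ((A.erase t : Finset V) : Set V)),
          y ⟨t, htX⟩ = 0 := by
        intro y hy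
        induction hy using Submodule.span_induction with
        | mem y hy =>
          obtain ⟨a, ha, rfl⟩ := hy
          exact aux_P_zero f hf H hH t _ a (Nat.lt_succ_self _) (by rw [hft]; exact hA' a ha)
        | zero => rfl
        | add y z _ _ hy hz => rw [Pi.add_apply, hy, hz, add_zero]
        | smul b y _ hy => rw [Pi.smul_apply, hy, smul_zero]
      have := h0 _ hmem
      rw [auxp, aux_P_one f hf H hH t] at this
      exact one_ne_zero this
    by_cases hall : ∀ s, E t s →
        auxp H X s ∈ Submodule.span K (auxp H X '' ((A.erase t : Finset V) : Set V))
    · obtain ⟨Z, hZ, hc⟩ := ih (A.erase t ∪ Finset.univ.filter fun s => E t s) (by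
        intro a ha
        rcases Finset.mem_union.1 ha with ha | ha
        · exact hA' a ha
        · have := hf _ _ (Finset.mem_filter.1 ha).2
          omega)
      refine ⟨Z, hZ.trans ?_, ?_⟩
      · refine (?_ : _ ≤ auxr (K := K) (auxp H X) (A.erase t)).trans
          (auxr_mono _ _ _ (Finset.erase_subset _ _))
        apply Submodule.finrank_mono
        rw [Submodule.span_le]
        rintro _ ⟨a, ha, rfl⟩
        rcases Finset.mem_union.1 ha with ha | ha
        · exact Submodule.subset_span ⟨a, ha, rfl⟩
        · exact hall a (Finset.mem_filter.1 ha).2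
      · intro a ha
        by_cases hat : a = t
        · subst hat
          apply AuxCut.of_children htX
          intro w hw
          exact hc w (Finset.mem_union_right _ (by simpa using hw))
        · exact hc a (Finset.mem_union_left _ (Finset.mem_erase.2 ⟨hat, ha⟩))
    · push Not at hall
      obtain ⟨s0, hE, hs0⟩ := hall
      obtain ⟨τ, c, hc, h1, h2, h3⟩ := hgen t s0 hE
      exact hfin (aux_generic_step f hf H hH X _ t s0 hE htX (fun a ha => hft ▸ hA' a ha)
        τ c hc h1 h2 h3 hs0)

end generic

/-! ### Translation automorphisms -/

/-- Translation hom on polynomials. -/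
noncomputable def auxTr {ι : Type*} (c : ι → ℝ) : MvPolynomial ι ℝ →ₐ[ℝ] MvPolynomial ι ℝ :=
  MvPolynomial.aeval fun i => MvPolynomial.X i + MvPolynomial.C (c i)

theorem auxTr_comp {ι : Type*} (c : ι → ℝ) : (auxTr c).comp (auxTr (-c)) = AlgHom.id ℝ _ := by
  ext i : 1
  simp [auxTr]

theorem auxTr_comp' {ι : Type*} (c : ι → ℝ) : (auxTr (-c)).comp (auxTr c) = AlgHom.id ℝ _ := by
  ext i : 1
  simp [auxTr]

/-- Translation automorphism of the field. -/
noncomputable def auxT {V : Type*} (c : GVar V → ℝ) : GField V ≃+* GField V :=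
  IsFractionRing.ringEquivOfRingEquiv
    (AlgEquiv.ofAlgHom (auxTr c) (auxTr (-c)) (auxTr_comp c) (auxTr_comp' c)).toRingEquiv

theorem auxT_gv {V : Type*} (c : GVar V → ℝ) (i : GVar V) :
    auxT c (gv i) = gv i + gconst (c i) := by
  unfold auxT gv gconst
  rw [IsFractionRing.ringEquivOfRingEquiv_algebraMap, ← map_add]
  congr 1
  simp [auxTr]

theorem gconst_zero {V : Type*} : (gconst 0 : GField V) = 0 := by simp [gconst]
theorem gconst_one {V : Type*} : (gconst 1 : GField V) = 1 := by simp [gconst]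

theorem gconst_inj {V : Type*} : Function.Injective (gconst : ℝ → GField V) :=
  (IsFractionRing.injective (MvPolynomial (GVar V) ℝ) (GField V)).comp
    (MvPolynomial.C_injective _ _)

theorem gv_ne_zero {V : Type*} (i : GVar V) : (gv i : GField V) ≠ 0 := by
  unfold gv
  rw [Ne, IsFractionRing.to_map_eq_zero_iff]
  exact MvPolynomial.X_ne_zero i

theorem aux_den_ne {V : Type*} (Kf : V × V → Finset ℕ) (v w : V) : 1 - lagPoly Kf v w ≠ 0 := by
  have : (1 - lagPoly Kf v w : GField V) = algebraMap (MvPolynomial (GVar V) ℝ) (GField V)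
      (1 - ∑ k ∈ Kf (v, w), MvPolynomial.X (GVar.phi v w k) * MvPolynomial.X GVar.z ^ k) := by
    simp [lagPoly, gv]
  rw [this, Ne, IsFractionRing.to_map_eq_zero_iff]
  intro h
  have := congrArg (MvPolynomial.eval (0 : GVar V → ℝ)) h
  simp at this

theorem auxT_lag {V : Type*} (Kf : V × V → Finset ℕ) (c : GVar V → ℝ) (v w : V)
    (hz : c GVar.z = 0) (h : ∀ k, c (GVar.phi v w k) = 0) :
    auxT c (lagPoly Kf v w) = lagPoly Kf v w := by
  simp only [lagPoly, map_sum, map_mul, map_pow, auxT_gv, hz, h, gconst_zero, add_zero]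

theorem aux_hgen {V : Type*} [DecidableEq V] (DO : Finset (V × V))
    (hDO : ∀ p ∈ DO, p.1 ≠ p.2) (Kf : V × V → Finset ℕ) (hKedge : ∀ p ∈ DO, (Kf p).Nonempty)
    (t s0 : V) (hE : (t, s0) ∈ DO) : ∃ (τ : GField V →+* GField V) (c : GField V), c ≠ 0 ∧
      (∀ v w, v ≠ t → w ≠ t → τ (Hmat DO Kf v w) = Hmat DO Kf v w) ∧
      (∀ s, s ≠ s0 → τ (Hmat DO Kf t s) = Hmat DO Kf t s) ∧
      τ (Hmat DO Kf t s0) = Hmat DO Kf t s0 + c := by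
  classical
  have hne : t ≠ s0 := hDO _ hE
  obtain ⟨k, hk⟩ := hKedge _ hE
  let c : GVar V → ℝ := fun i => if i = GVar.phi t s0 k then 1 else 0
  have hz : c GVar.z = 0 := by simp [c]
  have hl : ∀ v w, ¬ (v = t ∧ w = s0) → auxT c (lagPoly Kf v w) = lagPoly Kf v w := by
    intro v w h
    refine auxT_lag Kf c v w hz fun k' => ?_
    simp only [c, GVar.phi.injEq]
    rw [if_neg]
    tauto
  have hH : ∀ v w, ¬ (v = t ∧ w = s0) → auxT c (Hmat DO Kf v w) = Hmat DO Kf v w := by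
    intro v w h
    unfold Hmat
    split_ifs
    · rw [map_div₀, map_sub, map_one, hl v w h, hl w w (by rintro ⟨h1, h2⟩; exact hne (h1.symm.trans h2))]
    · exact map_zero _
  have hlt : auxT c (lagPoly Kf t s0) = lagPoly Kf t s0 + gv GVar.z ^ k := by
    simp only [lagPoly, map_sum, map_mul, map_pow, auxT_gv, hz, gconst_zero, add_zero, add_mul,
      Finset.sum_add_distrib]
    congr 1
    rw [Finset.sum_eq_single k]
    · simp [c, gconst_one]
    · intro b _ hb
      simp [c, hb, gconst_zero]
    · exact fun h => absurd hk h
  refine ⟨(auxT c).toRingHom, gv GVar.z ^ k / (1 - lagPoly Kf s0 s0), ?_, ?_, ?_, ?_⟩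
  · exact div_ne_zero (pow_ne_zero _ (gv_ne_zero _)) (aux_den_ne _ _ _)
  · exact fun v w h1 h2 => hH v w (by tauto)
  · exact fun s h => hH t s (by tauto)
  · show auxT c _ = _
    unfold Hmat
    rw [if_pos hE, map_div₀, map_sub, map_one, hlt, hl s0 s0 (by rintro ⟨rfl, h⟩; exact hne rfl),
      add_div]

theorem aux_lower {V K : Type*} [Fintype V] [DecidableEq V] [Field K] (P Q : Matrix V V K)
    (w d : V → K) (hd : ∀ t, d t ≠ 0) (ι : ℝ → K) (hι : Function.Injective ι) (X Y : Finset V)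
    (r : ℕ)
    (hr : ∀ c : V → ℝ, ((Pᵀ * Matrix.diagonal (fun t => (w t + ι (c t)) * d t) * Q).submatrix
      (fun a : {u // u ∈ X} => (a : V)) (fun b : {u // u ∈ Y} => (b : V))).rank ≤ r)
    (I : Finset V) (L : Matrix {u // u ∈ X} {u // u ∈ I} K)
    (L' : Matrix {u // u ∈ Y} {u // u ∈ I} K)
    (hL : (Matrix.of fun (i : {v // v ∈ I}) (x : {u // u ∈ X}) => P i x) * L = 1)
    (hL' : (Matrix.of fun (i : {v // v ∈ I}) (y : {u // u ∈ Y}) => Q i y) * L' = 1) :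
    I.card ≤ r := by
  by_contra! hlt
  let A : Matrix {u // u ∈ I} V K := Lᵀ * Pᵀ.submatrix (fun a : {u // u ∈ X} => (a : V)) id
  let B : Matrix V {u // u ∈ I} K := Q.submatrix id (fun b : {u // u ∈ Y} => (b : V)) * L'
  have hA : ∀ i t : {u // u ∈ I}, A i t = (1 : Matrix {u // u ∈ I} {u // u ∈ I} K) t i := by
    intro i t
    rw [← hL]
    simp [A, Matrix.mul_apply, mul_comm]
  have hB : ∀ t j : {u // u ∈ I}, B t j = (1 : Matrix {u // u ∈ I} {u // u ∈ I} K) t j := by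
    intro i t
    rw [← hL']
    simp [B, Matrix.mul_apply]
  have hAB : ∀ u : V → K, A * Matrix.diagonal u * B =
      Lᵀ * (Pᵀ * Matrix.diagonal u * Q).submatrix
      (fun a : {u // u ∈ X} => (a : V)) (fun b : {u // u ∈ Y} => (b : V)) * L' := by
    intro u
    have : (Pᵀ * Matrix.diagonal u * Q).submatrix
      (fun a : {u // u ∈ X} => (a : V)) (fun b : {u // u ∈ Y} => (b : V)) =
      Pᵀ.submatrix (fun a : {u // u ∈ X} => (a : V)) id * Matrix.diagonal u *
      Q.submatrix id (fun b : {u // u ∈ Y} => (b : V)) := by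
      ext x y
      simp [Matrix.mul_apply, Matrix.mul_diagonal]
    rw [this]
    simp only [A, B, Matrix.mul_assoc]
  have hdet : ∀ c : V → ℝ,
      (A * Matrix.diagonal (fun t => (w t + ι (c t)) * d t) * B).det = 0 := by
    intro c
    by_contra hne
    have h1 := Matrix.rank_of_det_ne_zero hne
    rw [hAB] at h1
    have h2 := (Matrix.rank_mul_le_left (Lᵀ * (Pᵀ * Matrix.diagonal (fun t => (w t + ι (c t)) * d t) * Q).submatrix
      (fun a : {u // u ∈ X} => (a : V)) (fun b : {u // u ∈ Y} => (b : V))) L').trans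
      ((Matrix.rank_mul_le_right _ _).trans (hr c))
    rw [h1] at h2
    simp at h2
    omega
  let N : Matrix {u // u ∈ I} {u // u ∈ I} (MvPolynomial V K) :=
    (A.map (MvPolynomial.C (σ := V)) : Matrix {u // u ∈ I} V (MvPolynomial V K)) * Matrix.diagonal
      (fun t => (MvPolynomial.C (w t) + MvPolynomial.X t) * MvPolynomial.C (d t)) *
      B.map (MvPolynomial.C (σ := V))
  have hN : ∀ x : V → K, MvPolynomial.eval x N.det =
      (A * Matrix.diagonal (fun t => (w t + x t) * d t) * B).det := by
    intro x
    rw [RingHom.map_det]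
    congr 1
    ext i j
    rw [RingHom.mapMatrix_apply, Matrix.map_apply]
    simp only [N]
    rw [Matrix.mul_apply, Matrix.mul_apply, map_sum]
    refine Finset.sum_congr rfl fun t _ => ?_
    rw [Matrix.mul_diagonal, Matrix.mul_diagonal]
    simp
  have hN0 : N.det = 0 := by
    refine MvPolynomial.funext_set (fun _ => Set.range ι) (fun _ => Set.infinite_range_of_injective hι) ?_
    intro x hx
    choose c hc using fun t => hx t (Set.mem_univ t)
    have := hdet c
    rw [hN, map_zero, ← this]
    simp only [hc]
  have hfin := hN (fun t => (if t ∈ I then 1 else 0) / d t - w t)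
  rw [hN0, map_zero] at hfin
  have h1 : A * Matrix.diagonal (fun t => (w t + ((if t ∈ I then 1 else 0) / d t - w t)) * d t) * B
      = 1 := by
    ext i j
    rw [Matrix.mul_apply]
    simp only [Matrix.mul_diagonal]
    have : ∀ t, A i t * ((w t + ((if t ∈ I then 1 else 0) / d t - w t)) * d t) * B t j =
        if t ∈ I then A i t * B t j else 0 := by
      intro t
      rw [add_sub_cancel, div_mul_cancel₀ _ (hd t)]
      split_ifs <;> simp
    simp only [this]
    rw [← Finset.sum_filter, Finset.filter_mem_eq_inter, Finset.univ_inter, ← Finset.sum_coe_sort]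
    simp only [hA, hB]
    simp [Matrix.one_apply, eq_comm]
  rw [h1, Matrix.det_one] at hfin
  exact zero_ne_one hfin

/-- in the generic frequency-domain parameterisation of an acyclic process
graph `G = (V, D)`, for (not necessarily disjoint) subsets `X, Y ⊆ V`, the rank of
`[S]_{X,Y}` over `𝕂` equals `min{ |Z_X| + |Z_Y| : (Z_X, Z_Y) t-separates X from Y }`. -/
theorem rank_Smat_submatrix_eq_min_tsep
    {V : Type u} [Fintype V] [DecidableEq V]
    (DO : Finset (V × V)) (hDO : ∀ p ∈ DO, p.1 ≠ p.2)
    (hacyc : ∀ v : V, ¬ Relation.TransGen (fun v w => (v, w) ∈ DO) v v)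
    (Kf : V × V → Finset ℕ)
    (hKedge : ∀ p ∈ DO, (Kf p).Nonempty)
    (hKself : ∀ v : V, 0 ∉ Kf (v, v))
    (σ : GField V ≃+* GField V)
    (hσz : σ (gv (GVar.z : GVar V)) = (gv (GVar.z : GVar V))⁻¹)
    (hσφ : ∀ (v w : V) (k : ℕ), σ (gv (GVar.phi v w k)) = gv (GVar.phi v w k))
    (hσω : ∀ v : V, σ (gv (GVar.omega v)) = gv (GVar.omega v))
    (hσR : ∀ a : ℝ, σ (gconst a) = (gconst a : GField V))
    (X Y : Finset V) :
    ((Smat DO Kf σ).submatrix (fun a : {u // u ∈ X} => (a : V))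
        (fun b : {u // u ∈ Y} => (b : V))).rank =
      sInf {n : ℕ | ∃ ZX ZY : Finset V,
        TSep (fun v w => (v, w) ∈ DO) X Y ZX ZY ∧ ZX.card + ZY.card = n} := by
  classical
  obtain ⟨f, hinj, hf⟩ := aux_order (fun v w => (v, w) ∈ DO) hacyc
  set H := Hmat DO Kf with hHdef
  have hH : ∀ v w, ¬ (v, w) ∈ DO → H v w = 0 := fun v w h => if_neg h
  have hH' : ∀ v w, ¬ (v, w) ∈ DO → (H.map σ) v w = 0 := fun v w h => by
    rw [Matrix.map_apply, hH v w h, map_zero]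
  have hinv : (1 - H) * (1 - H)⁻¹ = 1 := Matrix.mul_nonsing_inv _ (aux_isUnit_det f hf H hH)
  -- inverses and ring homs
  have hmapinv : ∀ (ρ : GField V →+* GField V) (M : Matrix V V (GField V)),
      (1 - M) * (1 - M)⁻¹ = 1 → (1 - M.map ρ)⁻¹ = ((1 - M)⁻¹).map ρ := by
    intro ρ M hM
    apply Matrix.inv_eq_right_inv
    have h1 : (1 - M.map ρ) = (1 - M).map ρ := by
      rw [Matrix.map_sub _ (map_sub ρ), Matrix.map_one _ (map_zero ρ) (map_one ρ)]
    rw [h1, ← Matrix.map_mul, hM, Matrix.map_one _ (map_zero ρ) (map_one ρ)]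
  have hPσ : (1 - H.map σ)⁻¹ = ((1 - H)⁻¹).map σ := hmapinv σ.toRingHom H hinv
  have hinv' : (1 - H.map σ) * (1 - H.map σ)⁻¹ = 1 :=
    Matrix.mul_nonsing_inv _ (aux_isUnit_det f hf _ hH')
  let d : V → GField V := fun v => ((1 - lagPoly Kf v v) * σ (1 - lagPoly Kf v v))⁻¹
  have hd : ∀ t, d t ≠ 0 := fun t => inv_ne_zero (mul_ne_zero (aux_den_ne _ _ _)
    (by rw [Ne, map_eq_zero]; exact aux_den_ne _ _ _))
  have hS : Smat DO Kf σ = ((1 - H)⁻¹)ᵀ *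
      Matrix.diagonal (fun t => gv (GVar.omega t) * d t) * (1 - H.map σ)⁻¹ := by
    unfold Smat SImat
    rw [Matrix.transpose_nonsing_inv]
    rfl
  apply le_antisymm
  · refine le_csInf ⟨_, X, Y, ?_, rfl⟩ ?_
    · intro τ h1 _
      exact Or.inl ⟨_, List.getLast_mem _, h1⟩
    · rintro n ⟨ZX, ZY, hsep, rfl⟩
      rw [hS]
      exact aux_upper f hf H (H.map σ) hH hH' X Y ZX ZY _ hsep
  · obtain ⟨I, U, -, h1, h2, h3⟩ := aux_matroid_inter
      (auxr (K := GField V) (auxp H X)) (auxr (K := GField V) (auxp H Y))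
      (auxr_mono _) (auxr_mono _) (auxr_sub _) (auxr_sub _) (auxr_insert_le _)
      (auxr_insert_le _) Finset.univ ∅
    have h0 : ∀ W, auxr (K := GField V) (auxp H W) ∅ = 0 := fun W => by simp [auxr]
    simp only [Finset.empty_union, h0, zero_add, add_zero] at h1 h2 h3
    have hgen := aux_hgen DO hDO Kf hKedge
    have hmen : ∀ W A : Finset V, ∃ Z : Finset V,
        Z.card ≤ auxr (K := GField V) (auxp H W) A ∧
          ∀ a ∈ A, AuxCut (fun v w => (v, w) ∈ DO) W Z a := by
      intro W A
      exact aux_menger f hf hinj H hH hgen W (A.sup f + 1) A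
        (fun a ha => Nat.lt_succ_of_le (Finset.le_sup ha))
    obtain ⟨ZX, hZX, hcX⟩ := hmen X U
    obtain ⟨ZY, hZY, hcY⟩ := hmen Y (Finset.univ \ U)
    have hsep : TSep (fun v w => (v, w) ∈ DO) X Y ZX ZY := by
      intro τ hx hy
      by_cases ht : τ.left.first ∈ U
      · exact Or.inl (hcX _ ht τ.left rfl hx)
      · exact Or.inr (hcY _ (by simpa using ht) τ.right τ.top_eq.symm hy)
    have hmem : ZX.card + ZY.card ∈ {n : ℕ | ∃ ZX ZY : Finset V,
        TSep (fun v w => (v, w) ∈ DO) X Y ZX ZY ∧ ZX.card + ZY.card = n} :=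
      ⟨ZX, ZY, hsep, rfl⟩
    refine (Nat.sInf_le hmem).trans ?_
    refine ((Nat.add_le_add hZX hZY).trans h3).trans ?_
    obtain ⟨L, hL⟩ := aux_right_inv _ I h1
    obtain ⟨L', hL'⟩ := aux_right_inv _ I h2
    refine aux_lower (1 - H)⁻¹ (1 - H.map σ)⁻¹ (fun t => gv (GVar.omega t)) d hd gconst
      gconst_inj X Y _ ?_ I L (L'.map σ) hL ?_
    · intro c
      let c' : GVar V → ℝ := fun i => match i with
        | GVar.omega v => c v
        | _ => 0
      have hz : auxT c' (gv GVar.z) = gv GVar.z := by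
        rw [auxT_gv]; simp [c', gconst_zero]
      have hφ : ∀ v w k, auxT c' (gv (GVar.phi v w k)) = gv (GVar.phi v w k) := by
        intro v w k; rw [auxT_gv]; simp [c', gconst_zero]
      have hl : ∀ v w, auxT c' (lagPoly Kf v w) = lagPoly Kf v w :=
        fun v w => auxT_lag Kf c' v w rfl (fun _ => rfl)
      have hlσ : ∀ v w, auxT c' (σ (lagPoly Kf v w)) = σ (lagPoly Kf v w) := by
        intro v w
        simp only [lagPoly, map_sum, map_mul, map_pow, hσφ, hσz, map_inv₀, hz, hφ]
      have hHT : H.map (auxT c') = H := by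
        ext v w
        rw [Matrix.map_apply, hHdef, Hmat]
        split_ifs
        · rw [map_div₀, map_sub, map_one, hl, hl]
        · exact map_zero _
      have hHT' : (H.map σ).map (auxT c') = H.map σ := by
        ext v w
        rw [Matrix.map_apply, Matrix.map_apply, hHdef, Hmat]
        split_ifs
        · simp only [map_div₀, map_sub, map_one, hlσ]
        · simp only [map_zero]
      have hP : ((1 - H)⁻¹).map (auxT c') = (1 - H)⁻¹ := by
        have := hmapinv (auxT c').toRingHom H hinv
        exact this.symm.trans (congrArg (fun M => (1 - M)⁻¹) hHT)
      have hP' : ((1 - H.map σ)⁻¹).map (auxT c') = (1 - H.map σ)⁻¹ := by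
        have := hmapinv (auxT c').toRingHom (H.map σ) hinv'
        exact this.symm.trans (congrArg (fun M => (1 - M)⁻¹) hHT')
      have hdT : ∀ t, auxT c' (d t) = d t := by
        intro t
        simp only [d, map_inv₀, map_mul, map_sub, map_one, hl, hlσ]
      refine le_trans (le_of_eq ?_) (aux_rank_map_le _ (auxT c').toRingHom)
      congr 1
      rw [hS]
      ext x y
      have hPe : ∀ a b, auxT c' ((1 - H)⁻¹ a b) = (1 - H)⁻¹ a b :=
        fun a b => congrFun (congrFun hP a) b
      have hPe' : ∀ a b, auxT c' ((1 - H.map σ)⁻¹ a b) = (1 - H.map σ)⁻¹ a b :=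
        fun a b => congrFun (congrFun hP' a) b
      have hω : ∀ t, auxT c' (gv (GVar.omega t)) = gv (GVar.omega t) + gconst (c t) :=
        fun t => auxT_gv _ _
      show _ = auxT c' _
      simp only [Matrix.submatrix_apply, Matrix.mul_apply (M := _ * _), Matrix.mul_diagonal,
        Matrix.transpose_apply, map_sum, map_mul, hPe, hPe', hω, hdT]
    · rw [hPσ]
      have := congrArg (fun M => M.map σ) hL'
      simp only [Matrix.map_mul, Matrix.map_one _ (map_zero σ) (map_one σ)] at this
      exact this
end

section
/- Let K be a field, V a finite set, S ∈ K^{V×V} a matrix, and X, Y, Z ⊆ V pairwise disjoint subsets such that the submatrix [S]_{Z,Z} is invertible. Then the Schur complement [S]_{X,Y} − [S]_{X,Z}·[S]_{Z,Z}⁻¹·[S]_{Z,Y} is the zero matrix if and only if the rank of [S]_{X∪Z, Y∪Z} equals |Z|. -/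
open Matrix

theorem rank_aux {K m n z : Type*} [Field K] [Fintype m] [Fintype n] [Fintype z]
    [DecidableEq n] [DecidableEq z]
    (M : Matrix m n K) (r : z → m) (c : z → n) (hA : IsUnit (M.submatrix r c)) :
    M.rank = Fintype.card z ↔
      M = M.submatrix id c * (M.submatrix r c)⁻¹ * M.submatrix r id := by
  have hdet := (Matrix.isUnit_iff_isUnit_det _).1 hA
  have hrA := Matrix.rank_of_isUnit _ hA
  have h1 : Fintype.card z ≤ M.rank := hrA ▸ Matrix.rank_submatrix_le M r c
  constructor
  · intro h
    have h2 : Fintype.card z ≤ (M.submatrix id c).rank := by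
      have := Matrix.rank_submatrix_le (M.submatrix id c) r id
      rw [← hrA]
      simpa using this
    have hle : LinearMap.range (M.submatrix id c).mulVecLin ≤ LinearMap.range M.mulVecLin := by
      rw [Matrix.range_mulVecLin, Matrix.range_mulVecLin]
      apply Submodule.span_mono
      rintro _ ⟨j, rfl⟩
      exact ⟨c j, rfl⟩
    have heq := Submodule.eq_of_le_of_finrank_le hle (by
      change M.rank ≤ (M.submatrix id c).rank
      omega)
    ext i j
    have hj : M.col j ∈ LinearMap.range (M.submatrix id c).mulVecLin := by
      rw [heq, Matrix.range_mulVecLin]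
      exact Submodule.subset_span ⟨j, rfl⟩
    obtain ⟨v, hv⟩ := hj
    have hr : (M.submatrix r c) *ᵥ v = fun k => M (r k) j := by
      ext k
      exact congrFun hv (r k)
    have hv2 : v = (M.submatrix r c)⁻¹ *ᵥ (fun k => M (r k) j) := by
      rw [← hr, Matrix.mulVec_mulVec, Matrix.nonsing_inv_mul _ hdet, Matrix.one_mulVec]
    have hi : ((M.submatrix id c) *ᵥ v) i = M i j := congrFun hv i
    rw [hv2, Matrix.mulVec_mulVec] at hi
    exact hi.symm
  · intro h
    refine le_antisymm ?_ h1
    rw [h]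
    exact (Matrix.rank_mul_le_left _ _).trans (Matrix.rank_le_card_width _)

/-- let `K` be a field, `S ∈ K^{V×V}` and `X, Y, Z ⊆ V` pairwise disjoint
with `[S]_{Z,Z}` invertible. Then the Schur complement
`[S]_{X,Y} − [S]_{X,Z}·[S]_{Z,Z}⁻¹·[S]_{Z,Y}` is zero if and only if the rank of
`[S]_{X∪Z, Y∪Z}` equals `|Z|`. -/
theorem schur_complement_eq_zero_iff_rank
    {K V : Type*} [Field K] [Fintype V] [DecidableEq V]
    (S : Matrix V V K) (X Y Z : Finset V)
    (hXY : Disjoint X Y) (hXZ : Disjoint X Z) (hYZ : Disjoint Y Z)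
    (hZ : IsUnit (S.submatrix (fun a : {u // u ∈ Z} => (a : V))
      (fun b : {u // u ∈ Z} => (b : V)))) :
    (S.submatrix (fun a : {u // u ∈ X} => (a : V)) (fun b : {u // u ∈ Y} => (b : V)) -
        S.submatrix (fun a : {u // u ∈ X} => (a : V)) (fun b : {u // u ∈ Z} => (b : V)) *
          (S.submatrix (fun a : {u // u ∈ Z} => (a : V))
              (fun b : {u // u ∈ Z} => (b : V)))⁻¹ *
          S.submatrix (fun a : {u // u ∈ Z} => (a : V)) (fun b : {u // u ∈ Y} => (b : V))
        = 0) ↔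
      (S.submatrix (fun a : {u // u ∈ X ∪ Z} => (a : V))
          (fun b : {u // u ∈ Y ∪ Z} => (b : V))).rank = Z.card := by
  classical
  have hZc : Z.card = Fintype.card {u // u ∈ Z} := by simp
  have key := rank_aux (S.submatrix (fun a : {u // u ∈ X ∪ Z} => (a : V))
          (fun b : {u // u ∈ Y ∪ Z} => (b : V)))
    (fun a : {u // u ∈ Z} => ⟨a.1, Finset.mem_union_right _ a.2⟩)
    (fun a : {u // u ∈ Z} => ⟨a.1, Finset.mem_union_right _ a.2⟩) hZ
  rw [hZc, key]
  simp only [Matrix.submatrix_submatrix]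
  have hdet := (Matrix.isUnit_iff_isUnit_det _).1 hZ
  set A := S.submatrix (fun a : {u // u ∈ Z} => (a : V)) (fun b : {u // u ∈ Z} => (b : V)) with hA
  rw [sub_eq_zero]
  constructor
  · intro h
    ext ⟨i, hi⟩ ⟨j, hj⟩
    by_cases hiZ : i ∈ Z
    · have e : A * A⁻¹ * S.submatrix (fun a : {u // u ∈ Z} => (a : V))
          (fun b : {u // u ∈ Y ∪ Z} => (b : V)) = S.submatrix (fun a : {u // u ∈ Z} => (a : V))
          (fun b : {u // u ∈ Y ∪ Z} => (b : V)) := by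
        rw [Matrix.mul_nonsing_inv _ hdet, Matrix.one_mul]
      exact (congrFun (congrFun e ⟨i, hiZ⟩) ⟨j, hj⟩).symm
    · have hiX : i ∈ X := (Finset.mem_union.1 hi).resolve_right hiZ
      by_cases hjZ : j ∈ Z
      · have e : S.submatrix (fun a : {u // u ∈ X} => (a : V)) (fun b : {u // u ∈ Z} => (b : V))
            * A⁻¹ * A = S.submatrix (fun a : {u // u ∈ X} => (a : V))
              (fun b : {u // u ∈ Z} => (b : V)) := by
          rw [Matrix.mul_assoc, Matrix.nonsing_inv_mul _ hdet, Matrix.mul_one]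
        exact (congrFun (congrFun e ⟨i, hiX⟩) ⟨j, hjZ⟩).symm
      · have hjY : j ∈ Y := (Finset.mem_union.1 hj).resolve_right hjZ
        exact congrFun (congrFun h ⟨i, hiX⟩) ⟨j, hjY⟩
  · intro h
    ext ⟨i, hi⟩ ⟨j, hj⟩
    exact congrFun (congrFun h ⟨i, Finset.mem_union_left _ hi⟩) ⟨j, Finset.mem_union_left _ hj⟩
end

section
/- Let G = (V, D) be a finite directed graph with V = O ⊔ L such that every l ∈ L has no incoming edge, and let X, Y ⊆ O be disjoint subsets with |X| = |Y| = n. Suppose there exists a system of latent-factor half-treks from X to Y without sided intersection. Then there exist enumerations X = {x_1, …, x_n}, Y = {y_1, …, y_n} and a system T = (τ_1, …, τ_n) of latent-factor half-treks without sided intersection, with τ_i a latent-factor half-trek from x_i to y_i, such that: (i) for all i, j, the vertex x_j occurs on τ_i only if i ≥ j, and x_i occurs exactly once on τ_i; (ii) the subgraph G(T) of G consisting of exactly the edges used by the treks of T is acyclic; and (iii) T is the unique trek system from X to Y without sided intersection all of whose edges lie in G(T). -/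
open scoped BigOperators

/-- The list of vertices visited by a trek, with the top counted once: the vertices of the
Left path followed by the vertices of the Right path other than the top. -/
def Trek.vertsList {V : Type*} {E : V → V → Prop} (τ : Trek E) : List V :=
  τ.left.verts ++ τ.right.verts.tail

/-- A latent-factor half-trek (for the partition of the vertices into observed set `O` and
latent set `L`): a trek that is either a directed path `v → x_1 → ⋯ → x_n → w` with all
vertices observed (the Left path is the empty path at `v = top`), or of the form
`v ← l → x_1 → ⋯ → x_n → w` with latent top `l ∈ L` and all other vertices observed. -/
def IsLFHT {V : Type*} {E : V → V → Prop} (O L : Set V) (τ : Trek E) : Prop :=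
  (τ.left.verts.length = 1 ∧ ∀ u ∈ τ.right.verts, u ∈ O) ∨
    (τ.left.verts.length = 2 ∧ τ.top ∈ L ∧ (∀ u ∈ τ.left.verts.tail, u ∈ O) ∧
      ∀ u ∈ τ.right.verts.tail, u ∈ O)

/-- The edge set `G(T)` of a trek system: the edges used by the treks of `T`. -/
def TrekSystem.edgeSet {V : Type*} {E : V → V → Prop} {r : ℕ} {x y : Fin r → V}
    (T : TrekSystem E r x y) (u w : V) : Prop :=
  ∃ i, (u, w) ∈ (T.trek i).left.edges ∨ (u, w) ∈ (T.trek i).right.edges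

/-- edges as infix -/
lemma mem_zip_tail {V : Type*} (l : List V) (u w : V) :
    (u, w) ∈ l.zip l.tail ↔ ∃ a c, l = a ++ u :: w :: c := by
  induction l with
  | nil => simp
  | cons b l ih =>
    cases l with
    | nil =>
      simp only [List.tail_cons, List.zip_nil_right, List.not_mem_nil, false_iff]
      rintro ⟨a, c, h⟩
      have := congrArg List.length h
      simp at this; omega
    | cons b' l =>
      simp only [List.tail_cons, List.zip_cons_cons, List.mem_cons, Prod.mk.injEq] at ih ⊢
      rw [ih]
      constructor
      · rintro (⟨rfl, rfl⟩ | ⟨a, c, h⟩)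
        · exact ⟨[], l, rfl⟩
        · exact ⟨b :: a, c, by simp [h]⟩
      · rintro ⟨a, c, h⟩
        cases a with
        | nil => simp at h; left; exact ⟨h.1.symm, h.2.1.symm⟩
        | cons a0 a => right; simp at h; exact ⟨a, c, h.2⟩

lemma nodup_split {V : Type*} {a c a' c' : List V} {w : V} (h : a ++ w :: c = a' ++ w :: c')
    (hn : (a ++ w :: c).Nodup) : a = a' ∧ c = c' := by
  have hn' := hn
  rw [h] at hn'
  have h1 : w ∉ a := by
    rw [List.nodup_append] at hn; intro hw; exact hn.2.2 w hw w (by simp) rfl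
  have h2 : w ∉ a' := by
    rw [List.nodup_append] at hn'; intro hw; exact hn'.2.2 w hw w (by simp) rfl
  induction a generalizing a' with
  | nil =>
    cases a' with
    | nil => simpa using h
    | cons b a' => simp at h h2; exact absurd h.1 h2.1
  | cons b a ih =>
    cases a' with
    | nil => simp at h h1; exact absurd h.1.symm h1.1
    | cons b' a' =>
      simp at h h1 h2 hn hn'
      have := ih h.2 (by simpa using hn.2) (by simpa using hn'.2) h1.2 h2.2
      exact ⟨by rw [h.1, this.1], this.2⟩

/-- shorten a path to a simple path -/
lemma exists_nodup {V : Type*} [DecidableEq V] (E : V → V → Prop) (l : List V) (hc : l.IsChain E) :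
    ∃ l' : List V, l'.IsChain E ∧ l'.Nodup ∧ l' ⊆ l ∧ l'.head? = l.head? ∧
      l'.getLast? = l.getLast? ∧ l'.length ≤ l.length := by
  induction l with
  | nil => exact ⟨[], by simp⟩
  | cons b l ih =>
    obtain ⟨l', h1, h2, h3, h4, h5, h6⟩ := ih hc.tail
    by_cases hb : b ∈ l'
    · obtain ⟨s, t, rfl⟩ := List.append_of_mem hb
      refine ⟨b :: t, h1.right_of_append, ?_, ?_, by simp, ?_, ?_⟩
      · exact (List.nodup_append.1 h2).2.1
      · intro v hv; exact List.mem_cons_of_mem _ (h3 (by simp at hv ⊢; tauto))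
      · cases l with
        | nil => simp at h3
        | cons c l => simp only [List.getLast?_cons_cons, ← h5]; rw [List.getLast?_append]; simp [List.getLast?_cons]
      · simp at h6 ⊢; omega
    · refine ⟨b :: l', ?_, by simp [hb, h2], ?_, by simp, ?_, by simpa using h6⟩
      · rw [List.isChain_cons] at hc ⊢
        rw [h4]; exact ⟨hc.1, h1⟩
      · exact List.cons_subset_cons _ h3
      · rw [List.getLast?_cons, List.getLast?_cons, h5]

lemma exists_cycle_perm {n : ℕ} (R : Fin n → Fin n → Prop) (i : Fin n)
    (h : Relation.TransGen R i i) :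
    ∃ (σ : Equiv.Perm (Fin n)) (S : Set (Fin n)), S.Nonempty ∧ (∀ j ∈ S, R j (σ j)) ∧
      (∀ j ∉ S, σ j = j) := by
  classical
  let S : Set (Fin n) := {j | Relation.TransGen R i j ∧ Relation.TransGen R j i}
  have hS : ∀ j : S, ∃ k : S, R j k := by
    rintro ⟨j, h1, h2⟩
    obtain ⟨k, hk, hk'⟩ := Relation.TransGen.head'_iff.1 h2
    refine ⟨⟨k, h1.tail hk, ?_⟩, hk⟩
    rcases Relation.reflTransGen_iff_eq_or_transGen.1 hk' with e | e
    · exact e ▸ h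
    · exact e
  choose f hf using hS
  let P := Function.periodicPts f
  have hP : P.Nonempty := by
    have : ¬ Function.Injective (fun m : ℕ => f^[m] ⟨i, h, h⟩) := not_injective_infinite_finite _
    simp only [Function.Injective, not_forall] at this
    obtain ⟨a, b, hab, hne⟩ := this
    have key : ∀ a b : ℕ, a < b → f^[a] ⟨i, h, h⟩ = f^[b] ⟨i, h, h⟩ → P.Nonempty := by
      intro a b hlt e
      refine ⟨f^[a] ⟨i, h, h⟩, Function.mk_mem_periodicPts (n := b - a) (by omega) ?_⟩
      rw [Function.IsPeriodicPt, Function.IsFixedPt, ← Function.iterate_add_apply, e]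
      congr 2; omega
    rcases lt_or_gt_of_ne hne with hlt | hlt
    · exact key a b hlt hab
    · exact key b a hlt hab.symm
  let S' : Set (Fin n) := Subtype.val '' P
  let g : Fin n → Fin n := fun j => if hj : ∃ h : j ∈ S, (⟨j, h⟩ : S) ∈ P then f ⟨j, hj.1⟩ else j
  have hb := Function.bijOn_periodicPts f
  have hg1 : ∀ j : S, j ∈ P → g j = f j := by
    intro j hj; simp only [g]; rw [dif_pos ⟨j.2, hj⟩]
  have hg2 : ∀ j, j ∉ S' → g j = j := by
    intro j hj; simp only [g]; rw [dif_neg]; rintro ⟨h1, h2⟩; exact hj ⟨_, h2, rfl⟩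
  have hginj : Function.Injective g := by
    intro a b hab
    by_cases ha : a ∈ S' <;> by_cases hb' : b ∈ S'
    · obtain ⟨a, ha, rfl⟩ := ha
      obtain ⟨b, hb', rfl⟩ := hb'
      rw [hg1 _ ha, hg1 _ hb'] at hab
      rw [hb.injOn ha hb' (Subtype.ext hab)]
    · obtain ⟨a, ha, rfl⟩ := ha
      rw [hg1 _ ha, hg2 _ hb'] at hab
      exact absurd ⟨_, hb.mapsTo ha, hab⟩ hb'
    · obtain ⟨b, hb', rfl⟩ := hb'
      rw [hg1 _ hb', hg2 _ ha] at hab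
      exact absurd ⟨_, hb.mapsTo hb', hab.symm⟩ ha
    · rwa [hg2 _ ha, hg2 _ hb'] at hab
  refine ⟨Equiv.ofBijective g (Finite.injective_iff_bijective.1 hginj), S', hP.image _, ?_, ?_⟩
  · rintro _ ⟨j, hj, rfl⟩
    simp only [Equiv.ofBijective_apply, hg1 j hj]; exact hf j
  · intro j hj; exact hg2 j hj

lemma exists_sort {n : ℕ} (R : Fin n → Fin n → Prop) (h : ∀ i, ¬ Relation.TransGen R i i) :
    ∃ e : Equiv.Perm (Fin n), ∀ i j, R (e i) (e j) → j < i := by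
  classical
  let rk : Fin n → ℕ := fun i => (Finset.univ.filter fun j => Relation.TransGen R i j).card
  refine ⟨Tuple.sort rk, fun i j hij => ?_⟩
  have h1 : rk (Tuple.sort rk j) < rk (Tuple.sort rk i) := by
    apply Finset.card_lt_card
    rw [Finset.ssubset_iff_of_subset]
    · exact ⟨Tuple.sort rk j, by simpa using .single hij, by simpa using h _⟩
    · intro k; simp only [Finset.mem_filter, Finset.mem_univ, true_and]
      exact fun hk => hk.head hij
  by_contra hcon
  have := Tuple.monotone_sort rk (not_lt.1 hcon)
  simp at this; omega

lemma perm_eq_one {n : ℕ} (σ : Equiv.Perm (Fin n)) (h : ∀ k, k ≤ σ k) : σ = 1 := by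
  have h1 : ∑ k, ((σ k : Fin n) : ℕ) = ∑ k : Fin n, (k : ℕ) := Equiv.sum_comp σ (fun k : Fin n => (k : ℕ))
  have h2 := (Finset.sum_eq_sum_iff_of_le (s := Finset.univ) (f := fun k : Fin n => (k : ℕ)) (g := fun k => ((σ k : Fin n) : ℕ)) (fun k _ => h k)).1 h1.symm
  ext k; exact (h2 k (Finset.mem_univ _)).symm

structure LSys {V : Type*} (E : V → V → Prop) (L : Set V) (X Y : Finset V) (n : ℕ)
    (x y : Fin n → V) (A B : Fin n → List V) : Prop where
  xi : Function.Injective x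
  yi : Function.Injective y
  xX : ∀ i, x i ∈ X
  yY : ∀ i, y i ∈ Y
  left : ∀ i, (A i = [x i] ∧ (B i).head? = some (x i)) ∨
    ∃ l ∈ L, A i = [l, x i] ∧ E l (x i) ∧ (B i).head? = some l
  chain : ∀ i, (B i).IsChain E
  last : ∀ i, (B i).getLast? = some (y i)
  ldisj : ∀ i j, i ≠ j → ∀ v ∈ A i, v ∉ A j
  rdisj : ∀ i j, i ≠ j → ∀ v ∈ B i, v ∉ B j

lemma LSys.reindex {V : Type*} {E : V → V → Prop} {L : Set V} {X Y : Finset V} {n : ℕ}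
    {x y : Fin n → V} {A B : Fin n → List V} (h : LSys E L X Y n x y A B)
    (e : Equiv.Perm (Fin n)) :
    LSys E L X Y n (fun i => x (e i)) (fun i => y (e i)) (fun i => A (e i)) (fun i => B (e i)) where
  xi := h.xi.comp e.injective
  yi := h.yi.comp e.injective
  xX i := h.xX _
  yY i := h.yY _
  left i := h.left _
  chain i := h.chain _
  last i := h.last _
  ldisj i j hij := h.ldisj _ _ (e.injective.ne hij)
  rdisj i j hij := h.rdisj _ _ (e.injective.ne hij)

lemma LSys.shrink {V : Type*} {E : V → V → Prop} {L : Set V} {X Y : Finset V} {n : ℕ}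
    {x y : Fin n → V} {A B : Fin n → List V} (h : LSys E L X Y n x y A B)
    (σ : Equiv.Perm (Fin n)) (A' B' : Fin n → List V)
    (hA : ∀ i, A' i ⊆ A i) (hB : ∀ i, B' i ⊆ B i)
    (hleft : ∀ i, (A' (σ i) = [x (σ i)] ∧ (B' i).head? = some (x (σ i))) ∨
      ∃ l ∈ L, A' (σ i) = [l, x (σ i)] ∧ E l (x (σ i)) ∧ (B' i).head? = some l)
    (hc : ∀ i, (B' i).IsChain E) (hl : ∀ i, (B' i).getLast? = some (y i)) :
    LSys E L X Y n x (fun i => y (σ.symm i)) A' (fun i => B' (σ.symm i)) where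
  xi := h.xi
  yi := h.yi.comp σ.symm.injective
  xX := h.xX
  yY i := h.yY _
  left i := by simpa using hleft (σ.symm i)
  chain i := hc _
  last i := hl _
  ldisj i j hij v hv hv' := h.ldisj i j hij v (hA _ hv) (hA _ hv')
  rdisj i j hij v hv hv' := h.rdisj _ _ (σ.symm.injective.ne hij) v (hB _ hv) (hB _ hv')

def lsize {V : Type*} {n : ℕ} (A B : Fin n → List V) : ℕ :=
  ∑ i, (A i).length + ∑ i, (B i).length

lemma exists_minimal {V : Type*} [DecidableEq V] {E : V → V → Prop} {L : Set V} {X Y : Finset V}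
    {n : ℕ} (h : ∃ x y A B, LSys E L X Y n x y A B) :
    ∃ x y A B, LSys E L X Y n x y A B ∧ (∀ i, (B i).Nodup) ∧
      ∀ i j, x j ∈ (B i).tail → j < i := by
  classical
  have hN : ∃ N, ∃ x y A B, LSys E L X Y n x y A B ∧ lsize A B = N := by
    obtain ⟨x, y, A, B, h⟩ := h
    exact ⟨_, x, y, A, B, h, rfl⟩
  obtain ⟨x, y, A, B, hs, hsz⟩ := Nat.find_spec hN
  have hmin : ∀ x' y' A' B', LSys E L X Y n x' y' A' B' → lsize A B ≤ lsize A' B' := by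
    intro x' y' A' B' h'
    rw [hsz]; exact Nat.find_min' hN ⟨x', y', A', B', h', rfl⟩
  have hxA : ∀ i, x i ∈ A i := by
    intro i
    rcases hs.left i with ⟨h1, _⟩ | ⟨l, _, h1, _⟩ <;> simp [h1]
  -- simple right paths
  have hnd : ∀ i, (B i).Nodup := by
    intro i
    choose B' h1 h2 h3 h4 h5 h6 using fun i => exists_nodup E (B i) (hs.chain i)
    have hs' := hs.shrink (Equiv.refl _) A B' (fun i => List.Subset.refl _) h3
      (fun i => by simpa [h4] using hs.left i) h1 (fun i => by rw [h5, hs.last])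
    have := hmin _ _ _ _ hs'
    simp only [lsize, Equiv.refl_symm, Equiv.refl_apply, add_le_add_iff_left] at this
    have heq := (Finset.sum_eq_sum_iff_of_le (fun i _ => h6 i)).1
      (le_antisymm (Finset.sum_le_sum fun i _ => h6 i) this) i (Finset.mem_univ _)
    have hsp : (B' i).Subperm (B i) := List.subperm_of_subset (h2 i) (h3 i)
    exact (hsp.perm_of_length_le heq.ge).nodup_iff.1 (h2 i)
  have hac : ∀ i, ¬ Relation.TransGen (fun i j => x j ∈ (B i).tail) i i := by
    intro i hi
    obtain ⟨σ, S, hSne, hS1, hS2⟩ := exists_cycle_perm _ i hi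
    have hσS : ∀ j, σ j ∈ S ↔ j ∈ S := by
      intro j
      constructor
      · intro hj; by_contra hj'; exact hj' (by rwa [hS2 j hj'] at hj)
      · intro hj; by_contra hj'
        have := σ.injective (hS2 _ hj')
        exact hj' (by rwa [this])
    have hsplit : ∀ j, ∃ t, j ∈ S → ((B j) ≠ t ∧ t <:+ B j ∧ t.head? = some (x (σ j))) := by
      intro j
      by_cases hj : j ∈ S
      · obtain ⟨a, c, hac⟩ := List.append_of_mem (hS1 j hj)
        refine ⟨x (σ j) :: c, fun _ => ?_⟩
        have hsuf : x (σ j) :: c <:+ (B j).tail := hac ▸ List.suffix_append _ _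
        have hlen := hsuf.length_le
        refine ⟨?_, hsuf.trans (List.tail_suffix _), rfl⟩
        intro e
        rw [e] at hlen
        simp at hlen
      · exact ⟨[], fun h => absurd h hj⟩
    choose t ht using hsplit
    let B' : Fin n → List V := fun j => if j ∈ S then t j else B j
    let A' : Fin n → List V := fun j => if j ∈ S then [x j] else A j
    have hBs : ∀ j, B' j <:+ B j := by
      intro j
      by_cases hj : j ∈ S
      · simp only [B', if_pos hj]; exact (ht j hj).2.1
      · simp only [B', if_neg hj]; exact List.suffix_refl _
    have hs' := hs.shrink σ A' B' ?_ (fun j => (hBs j).subset) ?_ (fun j => (hs.chain j).suffix (hBs j)) ?_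
    · have h1 := hmin _ _ _ _ hs'
      have h2 : ∑ j, (B' (σ.symm j)).length = ∑ j, (B' j).length :=
        Equiv.sum_comp σ.symm (fun j => (B' j).length)
      have h3 : ∑ j, (A' j).length ≤ ∑ j, (A j).length := by
        apply Finset.sum_le_sum
        intro j _
        by_cases hj : j ∈ S
        · simp only [A', if_pos hj]; exact List.length_pos_of_mem (hxA j)
        · simp only [A', if_neg hj]; exact le_rfl
      have h4 : ∑ j, (B' j).length < ∑ j, (B j).length := by
        apply Finset.sum_lt_sum (fun j _ => (hBs j).length_le)
        obtain ⟨j, hj⟩ := hSne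
        refine ⟨j, Finset.mem_univ _, lt_of_le_of_ne (hBs j).length_le ?_⟩
        intro e
        have := (hBs j).eq_of_length e
        simp only [B', if_pos hj] at this
        exact (ht j hj).1 this.symm
      simp only [lsize, h2] at h1
      omega
    · intro j
      by_cases hj : j ∈ S
      · simp only [A', if_pos hj]; simpa using hxA j
      · simp only [A', if_neg hj]; exact List.Subset.refl _
    · intro j
      by_cases hj : j ∈ S
      · left
        simp only [A', B', if_pos hj, if_pos ((hσS j).2 hj)]
        exact ⟨trivial, (ht j hj).2.2⟩
      · simp only [A', B', if_neg hj, if_neg (mt (hσS j).1 hj)]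
        rw [hS2 j hj]; exact hs.left j
    · intro j
      obtain ⟨a, ha⟩ := hBs j
      have hne : B' j ≠ [] := by
        by_cases hj : j ∈ S
        · simp only [B', if_pos hj]; intro e; have := (ht j hj).2.2; simp [e] at this
        · simp only [B', if_neg hj]; intro e; have := hs.last j; simp [e] at this
      rw [← hs.last j, ← ha, List.getLast?_append_of_ne_nil _ hne]
  obtain ⟨e, he⟩ := exists_sort _ hac
  exact ⟨_, _, _, _, hs.reindex e, fun i => hnd _, fun i j hij => he i j hij⟩

structure MSys {V : Type*} (E : V → V → Prop) (L : Set V) (X Y : Finset V) (n : ℕ)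
    (x y : Fin n → V) (A B : Fin n → List V) : Prop extends LSys E L X Y n x y A B where
  hl : ∀ l ∈ L, ∀ u, ¬ E u l
  hXL : ∀ i, x i ∉ L
  nd : ∀ i, (B i).Nodup
  ord : ∀ i j, x j ∈ (B i).tail → j < i

def lG {V : Type*} {n : ℕ} (A B : Fin n → List V) (u w : V) : Prop :=
  ∃ i, (u, w) ∈ (A i).zip (A i).tail ∨ (u, w) ∈ (B i).zip (B i).tail

namespace MSys
variable {V : Type*} [DecidableEq V] {E : V → V → Prop} {L : Set V} {X Y : Finset V} {n : ℕ}
    {x y : Fin n → V} {A B : Fin n → List V}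

lemma edge (h : MSys E L X Y n x y A B) {u w : V} (hG : lG A B u w) :
    (∃ i, u ∈ L ∧ A i = [u, x i] ∧ w = x i ∧ (B i).head? = some u) ∨
      ∃ i a c, B i = a ++ u :: w :: c := by
  obtain ⟨i, hi | hi⟩ := hG
  · left
    refine ⟨i, ?_⟩
    rcases h.left i with ⟨h1, h2⟩ | ⟨l, hl, h1, h2, h3⟩
    · simp [h1] at hi
    · simp [h1] at hi
      obtain ⟨rfl, rfl⟩ := hi
      exact ⟨hl, h1, rfl, h3⟩
  · right
    exact ⟨i, (mem_zip_tail _ _ _).1 hi⟩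

lemma edge_E (h : MSys E L X Y n x y A B) {i : Fin n} {u w : V} {a c : List V}
    (hB : B i = a ++ u :: w :: c) : E u w := by
  have := h.chain i
  rw [hB] at this
  exact (List.isChain_append_cons_cons.1 this).2.1

lemma tgt (h : MSys E L X Y n x y A B) {u w : V} (hG : lG A B u w) : w ∉ L := by
  rcases h.edge hG with ⟨i, h1, h2, h3, h4⟩ | ⟨i, a, c, hB⟩
  · rw [h3]; exact h.hXL i
  · intro hw; exact h.hl w hw u (h.edge_E hB)

lemma same (h : MSys E L X Y n x y A B) {i j : Fin n} {v : V} (hi : v ∈ B i) (hj : v ∈ B j) :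
    i = j := by
  by_contra hne; exact h.rdisj i j hne v hi hj

lemma tailL (h : MSys E L X Y n x y A B) {i : Fin n} {v : V} (hi : v ∈ (B i).tail) : v ∉ L := by
  have hc := h.chain i
  cases hB : B i with
  | nil => simp [hB] at hi
  | cons b l =>
    rw [hB] at hi
    simp only [List.tail_cons] at hi
    obtain ⟨s, t, rfl⟩ := List.append_of_mem hi
    intro hv
    rcases List.eq_nil_or_concat s with rfl | ⟨s', z, rfl⟩
    · exact h.hl v hv b (h.edge_E (i := i) (a := []) (c := t) (by simp [hB]))
    · exact h.hl v hv z (h.edge_E (i := i) (a := b :: s') (c := t) (by simp [hB]))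

lemma step (h : MSys E L X Y n x y A B) {i : Fin n} {u w : V} (hu : u ∉ L) (hi : u ∈ B i)
    (hG : lG A B u w) : ∃ a c, B i = a ++ u :: w :: c := by
  rcases h.edge hG with ⟨i, h1, h2, h3, h4⟩ | ⟨j, a, c, hB⟩
  · exact absurd h1 hu
  · have := h.same hi (j := j) (by simp [hB])
    subst this
    exact ⟨a, c, hB⟩

lemma reach (h : MSys E L X Y n x y A B) {i : Fin n} {u w : V} (hu : u ∉ L) (hi : u ∈ B i)
    (hG : Relation.TransGen (lG A B) u w) :
    w ∉ L ∧ w ∈ B i ∧ (B i).idxOf u < (B i).idxOf w := by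
  have key : ∀ v w, v ∉ L → v ∈ B i → lG A B v w →
      w ∉ L ∧ w ∈ B i ∧ (B i).idxOf v < (B i).idxOf w := by
    intro v w hv hvi hG
    obtain ⟨a, c, hB⟩ := h.step hv hvi hG
    refine ⟨h.tgt hG, by simp [hB], ?_⟩
    have hn := h.nd i
    rw [hB] at hn ⊢
    have hva : v ∉ a := fun hh => (List.nodup_append.1 hn).2.2 v hh v (by simp) rfl
    have hwa : w ∉ a := fun hh => (List.nodup_append.1 hn).2.2 w hh w (by simp) rfl
    have hvw : v ≠ w := by
      rintro rfl
      have := (List.nodup_append.1 hn).2.1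
      simp at this
    rw [List.idxOf_append_of_notMem hva, List.idxOf_append_of_notMem hwa]
    simp [List.idxOf_cons_ne _ hvw]
  induction hG with
  | single hG => exact key _ _ hu hi hG
  | tail _ hG ih =>
    obtain ⟨h1, h2, h3⟩ := key _ _ ih.1 ih.2.1 hG
    exact ⟨h1, h2, ih.2.2.trans h3⟩

lemma acyclic (h : MSys E L X Y n x y A B) (v : V) : ¬ Relation.TransGen (lG A B) v v := by
  intro hv
  obtain ⟨u, _, hu⟩ := Relation.TransGen.tail'_iff.1 hv
  have hvL := h.tgt hu
  obtain ⟨w, hw, _⟩ := Relation.TransGen.head'_iff.1 hv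
  rcases h.edge hw with ⟨i, h1, _⟩ | ⟨j, a, c, hB⟩
  · exact hvL h1
  · have := h.reach (i := j) hvL (by simp [hB]) hv
    exact lt_irrefl _ this.2.2

lemma chain_trans {G : V → V → Prop} {t : V} {l : List V} (hc : (t :: l).IsChain G) {v : V}
    (hv : v ∈ l) : Relation.TransGen G t v := by
  induction l generalizing t with
  | nil => simp at hv
  | cons w l ih =>
    rw [List.isChain_cons_cons] at hc
    rcases List.mem_cons.1 hv with rfl | hv
    · exact .single hc.1
    · exact .head hc.1 (ih hc.2 hv)

lemma left_case (h : MSys E L X Y n x y A B) {k j : Fin n} {t : V} {l : List V}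
    (hc : (t :: l).IsChain (lG A B)) (hlast : (t :: l).getLast? = some (x k)) (ht : t ∈ B j)
    (hx : x j ∈ t :: l → j = k) :
    k ≤ j ∧ (k = j → (B j).head? = some t ∧ t :: l = A j) := by
  have hmem : x k ∈ t :: l := List.mem_of_getLast? hlast
  by_cases htL : t ∈ L
  · cases l with
    | nil => simp at hlast; exact absurd (hlast ▸ htL) (h.hXL k)
    | cons w l =>
      have hc' := List.isChain_cons_cons.1 hc
      rcases h.edge hc'.1 with ⟨i, h1, h2, h3, h4⟩ | ⟨i, a, c, hB⟩
      · have hij : i = j := h.same (List.mem_of_head? h4) ht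
        subst hij
        have hik := hx (by simp [h3])
        subst hik
        refine ⟨le_rfl, fun _ => ⟨h4, ?_⟩⟩
        cases l with
        | nil => rw [h2, h3]
        | cons z l =>
          rw [List.getLast?_cons_cons, List.getLast?_cons_cons] at hlast
          rw [h3] at hc'
          exact absurd (chain_trans hc'.2 (List.mem_of_getLast? hlast)) (h.acyclic _)
      · have hij : i = j := h.same (v := t) (by simp [hB]) ht
        subst hij
        have hwL := h.tgt hc'.1
        have hwB : w ∈ B i := by simp [hB]
        have hxB : x k ∈ B i := by
          rw [List.getLast?_cons_cons] at hlast
          rcases List.mem_cons.1 (List.mem_of_getLast? hlast) with e | e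
          · rwa [e]
          · exact (h.reach hwL hwB (chain_trans hc'.2 e)).2.1
        have : x k ∈ (B i).tail := by
          have htl := fun hh => h.tailL (i := i) (v := t) hh htL
          cases hBi : B i with
          | nil => simp [hBi] at ht
          | cons b r =>
            rw [hBi] at ht htl hxB
            simp only [List.tail_cons] at htl ⊢
            rcases List.mem_cons.1 hxB with e | e
            · rcases List.mem_cons.1 ht with e' | e'
              · exact absurd (e.trans e'.symm ▸ htL) (h.hXL k)
              · exact absurd e' htl
            · exact e
        have := h.ord _ _ this
        exact ⟨this.le, fun e => absurd e this.ne⟩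
  · have hxB : x k ∈ B j := by
      rcases List.mem_cons.1 hmem with e | e
      · rwa [e]
      · exact (h.reach htL ht (chain_trans hc e)).2.1
    by_cases hxt : x k ∈ (B j).tail
    · have := h.ord _ _ hxt
      exact ⟨this.le, fun e => absurd e this.ne⟩
    · have hhead : (B j).head? = some (x k) := by
        cases hBi : B j with
        | nil => simp [hBi] at ht
        | cons b r =>
          rw [hBi] at hxB hxt
          rcases List.mem_cons.1 hxB with e | e
          · simp [e]
          · exact absurd e hxt
      rcases h.left j with ⟨h1, h2⟩ | ⟨l', hl', h1, h2, h3⟩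
      · rw [hhead] at h2
        have hkj : k = j := h.xi (Option.some.inj h2)
        subst hkj
        refine ⟨le_rfl, fun _ => ?_⟩
        cases l with
        | nil =>
          simp at hlast
          rw [hlast]; exact ⟨hhead, h1.symm⟩
        | cons w l =>
          rw [List.getLast?_cons_cons] at hlast
          have := (h.reach htL ht (chain_trans hc (List.mem_of_getLast? hlast))).2.2
          cases hBi : B k with
          | nil => simp [hBi] at ht
          | cons b r =>
            rw [hBi] at this hhead
            simp at hhead
            simp [hhead] at this
      · rw [hhead] at h3
        exact absurd (Option.some.inj h3 ▸ hl') (h.hXL k)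

lemma right_case (h : MSys E L X Y n x y A B) {m : Fin n} {b : V} {l : List V}
    (hc : (b :: l).IsChain (lG A B)) (hlast : (b :: l).getLast? = some (y m)) :
    b :: l <:+ B m ∨ ∃ j < m, b ∈ L ∧ b ∈ B j := by
  induction l generalizing b with
  | nil =>
    left
    simp at hlast
    subst hlast
    obtain ⟨a, ha⟩ := List.getLast?_eq_some_iff.1 (h.last m)
    exact ⟨a, ha.symm⟩
  | cons w l ih =>
    rw [List.isChain_cons_cons] at hc
    rw [List.getLast?_cons_cons] at hlast
    rcases ih hc.2 hlast with ⟨a, ha⟩ | ⟨j, _, hwL, _⟩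
    · have hwm : w ∈ B m := by simp [← ha]
      rcases h.edge hc.1 with ⟨i, h1, h2, h3, h4⟩ | ⟨i, a', c, hB⟩
      · right
        refine ⟨i, ?_, h1, List.mem_of_head? h4⟩
        by_cases hwt : w ∈ (B m).tail
        · exact h.ord _ _ (h3 ▸ hwt)
        · exfalso
          cases a with
          | nil =>
            rw [List.nil_append] at ha
            have hwx := h.hXL i
            rcases h.left m with ⟨h5, h6⟩ | ⟨l', hl', h5, h6, h7⟩
            · rw [← ha] at h6
              simp at h6
              have : i = m := h.xi (h3.symm.trans h6)
              subst this
              rw [← ha] at h4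
              simp at h4
              exact hwx (h3 ▸ h4 ▸ h1)
            · rw [← ha] at h7
              simp at h7
              exact hwx (h3 ▸ h7 ▸ hl')
          | cons z a => exact hwt (by simp [← ha])
      · left
        have him : i = m := h.same (v := w) (by simp [hB]) hwm
        subst him
        have hn := h.nd i
        have e : (a' ++ [b]) ++ w :: c = a ++ w :: l := by simp [ha, hB]
        have := nodup_split e (by simpa [hB] using hn)
        refine ⟨a', ?_⟩
        rw [hB, this.2]
    · exact absurd hwL (h.tgt hc.1)

lemma uniq (h : MSys E L X Y n x y A B) (A' B' : Fin n → List V) (σ : Equiv.Perm (Fin n))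
    (hA : ∀ k, (A' k).IsChain (lG A B)) (hB : ∀ k, (B' k).IsChain (lG A B))
    (hAl : ∀ k, (A' k).getLast? = some (x k)) (hBl : ∀ k, (B' k).getLast? = some (y (σ k)))
    (hh : ∀ k, (A' k).head? = (B' k).head?)
    (hd : ∀ i j, i ≠ j → ∀ v ∈ A' i, v ∉ A' j) :
    (∀ k, A' k = A k ∧ B' k = B k) ∧ σ = 1 := by
  have hform : ∀ k, ∃ t l r, A' k = t :: l ∧ B' k = t :: r := by
    intro k
    have h1 := hAl k
    have h2 := hBl k
    have h3 := hh k
    cases hA' : A' k with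
    | nil => simp [hA'] at h1
    | cons t l =>
      cases hB' : B' k with
      | nil => simp [hB'] at h2
      | cons s r => simp [hA', hB'] at h3; subst h3; exact ⟨t, l, r, rfl, rfl⟩
  have hL : ∀ k j t l, A' k = t :: l → t ∈ B j →
      k ≤ j ∧ (k = j → (B j).head? = some t ∧ t :: l = A j) := by
    intro k j t l e ht
    refine h.left_case (e ▸ hA k) (e ▸ hAl k) ht ?_
    intro hx
    by_contra hne
    exact hd j k hne (x j) (List.mem_of_getLast? (hAl j)) (e ▸ hx)
  have hσ : σ = 1 := by
    apply perm_eq_one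
    intro k
    obtain ⟨t, l, r, e1, e2⟩ := hform k
    rcases h.right_case (e2 ▸ hB k) (e2 ▸ hBl k) with hs | ⟨j, hj, _, hj'⟩
    · exact (hL k _ t l e1 (hs.subset (by simp))).1
    · exact ((hL k _ t l e1 hj').1.trans_lt hj).le
  subst hσ
  refine ⟨fun k => ?_, rfl⟩
  obtain ⟨t, l, r, e1, e2⟩ := hform k
  rcases h.right_case (e2 ▸ hB k) (e2 ▸ hBl k) with hs | ⟨j, hj, _, hj'⟩
  · rw [Equiv.Perm.one_apply] at hs
    obtain ⟨h1, h2⟩ := (hL k _ t l e1 (hs.subset (by simp))).2 rfl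
    refine ⟨e1.trans h2, ?_⟩
    obtain ⟨a, ha⟩ := hs
    obtain ⟨q, hq⟩ := List.head?_eq_some_iff.1 h1
    have hn := h.nd k
    have := nodup_split (a := []) (c := q) (a' := a) (c' := r) (w := t) (by simp [ha, hq]) (by simpa [hq] using hn)
    rw [e2, hq, this.2]
  · have := (hL k _ t l e1 hj').1.trans_lt hj
    simp at this

end MSys

lemma head?_first {V : Type*} {E : V → V → Prop} (p : DiPath E) : p.verts.head? = some p.first :=
  List.head?_eq_some_head p.ne

lemma getLast?_last {V : Type*} {E : V → V → Prop} (p : DiPath E) :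
    p.verts.getLast? = some p.last :=
  List.getLast?_eq_some_getLast p.ne

lemma chain_of_edges {V : Type*} (G : V → V → Prop) (l : List V)
    (h : ∀ u w, (u, w) ∈ l.zip l.tail → G u w) : l.IsChain G := by
  induction l with
  | nil => simp
  | cons a l ih =>
    cases l with
    | nil => simp
    | cons b l =>
      rw [List.isChain_cons_cons]
      exact ⟨h a b (by simp), ih fun u w hh => h u w (by simp at hh ⊢; tauto)⟩

/-- let `G = (V, D)` be a finite directed graph with `V = O ⊔ L` such that
every latent vertex has no incoming edge, and let `X, Y ⊆ O` be disjoint with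
`|X| = |Y| = n`. If there exists a system of latent-factor half-treks from `X` to `Y`
without sided intersection, then there exist enumerations of `X` and `Y` and a system
`T = (τ_1, …, τ_n)` of latent-factor half-treks without sided intersection, with `τ_i`
from `x_i` to `y_i`, such that: (i) `x_j` occurs on `τ_i` only if `i ≥ j`, and `x_i`
occurs on `τ_i` exactly once; (ii) the subgraph `G(T)` of edges used by `T` is acyclic;
and (iii) `T` is the unique trek system from `X` to `Y` without sided intersection all of
whose edges lie in `G(T)`. -/
theorem lfht_minimal_system
    {V : Type*} [Fintype V] [DecidableEq V]
    (E : V → V → Prop) (O L : Set V)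
    (hpart : ∀ v : V, v ∈ O ↔ v ∉ L)
    (hlat : ∀ l ∈ L, ∀ u, ¬ E u l)
    (n : ℕ) (X Y : Finset V)
    (hXO : ↑X ⊆ O) (hYO : ↑Y ⊆ O) (hXY : Disjoint X Y)
    (hXcard : X.card = n) (hYcard : Y.card = n)
    (hexists : ∃ x y : Fin n → V, Function.Injective x ∧ Function.Injective y ∧
      (∀ i, x i ∈ X) ∧ (∀ i, y i ∈ Y) ∧
      ∃ T : TrekSystem E n x y, ∀ i, IsLFHT O L (T.trek i)) :
    ∃ x y : Fin n → V, Function.Injective x ∧ Function.Injective y ∧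
      (∀ i, x i ∈ X) ∧ (∀ i, y i ∈ Y) ∧
      ∃ T : TrekSystem E n x y,
        (∀ i, IsLFHT O L (T.trek i)) ∧ T.perm = 1 ∧
        (∀ i j : Fin n, x j ∈ (T.trek i).vertsList → j ≤ i) ∧
        (∀ i : Fin n, (T.trek i).vertsList.count (x i) = 1) ∧
        (∀ v : V, ¬ Relation.TransGen T.edgeSet v v) ∧
        (∀ T' : TrekSystem E n x y,
          (∀ i u w, ((u, w) ∈ (T'.trek i).left.edges ∨ (u, w) ∈ (T'.trek i).right.edges) →
            T.edgeSet u w) →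
          (∀ i, (T'.trek i).left.verts = (T.trek i).left.verts ∧
            (T'.trek i).right.verts = (T.trek i).right.verts) ∧ T'.perm = T.perm) := by
  classical
  have hXL : ∀ v ∈ X, v ∉ L := fun v hv => (hpart v).1 (hXO hv)
  have hYL : ∀ v ∈ Y, v ∉ L := fun v hv => (hpart v).1 (hYO hv)
  have hinit : ∃ x y A B, LSys E L X Y n x y A B := by
    obtain ⟨x, y, hx, hy, hxX, hyY, T, hT⟩ := hexists
    refine ⟨x, fun i => y (T.perm i), fun i => (T.trek i).left.verts,
      fun i => (T.trek i).right.verts, hx, hy.comp T.perm.injective, hxX, fun i => hyY _,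
      ?_, fun i => (T.trek i).right.chain, ?_, T.left_disj, T.right_disj⟩
    · intro i
      have h1 := head?_first (T.trek i).right
      have h2 := (T.trek i).top_eq
      have h3 := T.left_last i
      have hc : List.IsChain E (T.trek i).left.verts := (T.trek i).left.chain
      rw [← h2] at h1
      rcases hT i with ⟨h4, _⟩ | ⟨h4, h5, _⟩
      · left
        obtain ⟨a, ha⟩ := List.length_eq_one_iff.1 h4
        simp only [DiPath.last, ha, List.getLast_singleton] at h3
        simp only [DiPath.first, ha, List.head_cons] at h1
        subst h3
        exact ⟨ha, h1⟩
      · right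
        obtain ⟨a, b, ha⟩ := List.length_eq_two.1 h4
        simp only [DiPath.last, ha] at h3
        simp only [DiPath.first, ha, List.head_cons] at h1
        simp only [Trek.top, DiPath.first, ha, List.head_cons] at h5
        rw [ha] at hc
        simp at h3 hc
        subst h3
        exact ⟨a, h5, ha, hc, h1⟩
    · intro i
      rw [← T.right_last i]
      exact getLast?_last _
  obtain ⟨x, y, A, B, hs, hnd, hord⟩ := exists_minimal hinit
  have hM : MSys E L X Y n x y A B :=
    { hs with hl := hlat, hXL := fun i => hXL _ (hs.xX i), nd := hnd, ord := hord }
  have hBne : ∀ i, B i ≠ [] := by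
    intro i e
    have := hs.last i
    simp [e] at this
  have hAne : ∀ i, A i ≠ [] := by
    intro i
    rcases hs.left i with ⟨h1, _⟩ | ⟨l, _, h1, _⟩ <;> simp [h1]
  have hAlast : ∀ i, (A i).getLast? = some (x i) := by
    intro i
    rcases hs.left i with ⟨h1, _⟩ | ⟨l, _, h1, _⟩ <;> simp [h1]
  have hAc : ∀ i, (A i).IsChain E := by
    intro i
    rcases hs.left i with ⟨h1, _⟩ | ⟨l, _, h1, h2, _⟩ <;> simp [h1]
    exact h2
  have hhead : ∀ i, (A i).head? = (B i).head? := by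
    intro i
    rcases hs.left i with ⟨h1, h2⟩ | ⟨l, _, h1, _, h2⟩ <;> simp [h1, h2]
  let T : TrekSystem E n x y :=
    { trek := fun i =>
        { left := ⟨A i, hAne i, hAc i⟩
          right := ⟨B i, hBne i, hs.chain i⟩
          top_eq := by
            have := hhead i
            rw [List.head?_eq_some_head (hAne i), List.head?_eq_some_head (hBne i)] at this
            exact Option.some.inj this }
      perm := 1
      left_last := fun i => by
        have := hAlast i
        rw [List.getLast?_eq_some_getLast (hAne i)] at this
        exact Option.some.inj this
      right_last := fun i => by
        have := hs.last i
        rw [List.getLast?_eq_some_getLast (hBne i)] at this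
        exact Option.some.inj this
      left_disj := hs.ldisj
      right_disj := hs.rdisj }
  refine ⟨x, y, hs.xi, hs.yi, hs.xX, hs.yY, T, ?_, rfl, ?_, ?_, hM.acyclic, ?_⟩
  · intro i
    rcases hs.left i with ⟨h1, h2⟩ | ⟨l, hl, h1, _, h2⟩
    · left
      refine ⟨by simp [T, h1], ?_⟩
      intro u hu
      change u ∈ B i at hu
      obtain ⟨q, hq⟩ := List.head?_eq_some_iff.1 h2
      rw [hq] at hu
      rcases List.mem_cons.1 hu with rfl | hu
      · exact hXO (hs.xX i)
      · exact (hpart u).2 (hM.tailL (i := i) (by simpa [hq] using hu))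
    · right
      refine ⟨by simp [T, h1], by simpa [T, Trek.top, DiPath.first, h1] using hl, ?_, ?_⟩
      · intro u hu
        simp [T, h1] at hu
        rw [hu]; exact hXO (hs.xX i)
      · intro u hu
        exact (hpart u).2 (hM.tailL hu)
  · intro i j hj
    change x j ∈ A i ++ (B i).tail at hj
    rcases List.mem_append.1 hj with hj | hj
    · by_contra hne
      exact hs.ldisj i j (by rintro rfl; exact hne le_rfl) _ hj (List.mem_of_getLast? (hAlast j))
    · exact (hord i j hj).le
  · intro i
    change (A i ++ (B i).tail).count (x i) = 1
    have h0 : (B i).tail.count (x i) = 0 :=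
      List.count_eq_zero.2 fun hh => lt_irrefl _ (hord i i hh)
    rw [List.count_append, h0]
    rcases hs.left i with ⟨h1, _⟩ | ⟨l, hl, h1, _⟩
    · simp [h1]
    · have : l ≠ x i := by rintro rfl; exact hM.hXL i hl
      simp [h1, List.count_cons, this]
  · intro T' hT'
    exact hM.uniq (fun k => (T'.trek k).left.verts) (fun k => (T'.trek k).right.verts) T'.perm
      (fun k => chain_of_edges _ _ fun u w hh => hT' k u w (Or.inl hh))
      (fun k => chain_of_edges _ _ fun u w hh => hT' k u w (Or.inr hh))
      (fun k => by rw [← T'.left_last k]; exact getLast?_last _)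
      (fun k => by rw [← T'.right_last k]; exact getLast?_last _)
      (fun k => by
        have h1 := head?_first (T'.trek k).left
        have h2 := head?_first (T'.trek k).right
        rw [← (T'.trek k).top_eq, ← h1] at h2
        exact h2.symm)
      T'.left_disj
end
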